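/- arXiv:1108.4192 — 2 statements merged into one kernel-verified Lean document; each statement's English description precedes it below -/
import Mathlib

section
/- Let Γ be a countably infinite group which has no finite-index normal subgroup isomorphic to ℤ or to ℤ², and let f ∈ ℤΓ be well-balanced. Then the homoclinic group Δ(X_f) = {x ∈ X_f : x_g → 0 in ℝ/ℤ along the cofinite filter on Γ} is dense in X_f. -/
open Filter Topology

/-- `f ∈ ℤΓ` is well-balanced: finitely supported, coefficients sum to `0`,
nonpositive off the identity, symmetric, and with support generating `Γ`. -/
def WellBalancedZ {G : Type*} [Group G] (f : G → ℤ) : Prop :=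
  (Function.support f).Finite ∧ (∑ᶠ s : G, f s) = 0 ∧
    (∀ s : G, s ≠ 1 → f s ≤ 0) ∧ (∀ s : G, f s⁻¹ = f s) ∧
    Subgroup.closure (Function.support f) = ⊤

/-- `X_f = {x ∈ (ℝ/ℤ)^Γ : ∀ t, ∑_s f_s · x_{ts} = 0}`. -/
def XfSet {G : Type*} [Group G] (f : G → ℤ) : Set (G → UnitAddCircle) :=
  {x | ∀ t : G, (∑ᶠ s : G, f s • x (t * s)) = 0}

section Duality

open MeasureTheory UnitAddTorus

lemma mFourier_apply_eq_toCircle {ι : Type*} [Fintype ι] (n : ι → ℤ) (x : ι → UnitAddCircle) :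
    mFourier n x = ((AddCircle.toCircle (∑ i, n i • x i) : Circle) : ℂ) := by
  have key : ∀ s : Finset ι, (∏ i ∈ s, (AddCircle.toCircle (n i • x i) : ℂ)) =
      ((AddCircle.toCircle (∑ i ∈ s, n i • x i) : Circle) : ℂ) := by
    classical
    intro s
    induction s using Finset.induction_on with
    | empty => simp
    | insert a s ha ih => rw [Finset.prod_insert ha, Finset.sum_insert ha, ih,
        AddCircle.toCircle_add, Circle.coe_mul]
  exact key Finset.univ

lemma mFourier_add_apply {ι : Type*} [Fintype ι] (n : ι → ℤ) (x y : ι → UnitAddCircle) :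
    mFourier n (x + y) = mFourier n x * mFourier n y := by
  simp [mFourier_apply_eq_toCircle, smul_add, Finset.sum_add_distrib, AddCircle.toCircle_add]

lemma mFourier_apply_eq_one_iff {ι : Type*} [Fintype ι] (n : ι → ℤ) (x : ι → UnitAddCircle) :
    mFourier n x = 1 ↔ ∑ i, n i • x i = 0 := by
  have h1 : (1 : ℂ) = ((AddCircle.toCircle (0 : UnitAddCircle) : Circle) : ℂ) := by
    rw [AddCircle.toCircle_zero, Circle.coe_one]
  rw [mFourier_apply_eq_toCircle, h1, Circle.coe_inj,
    (AddCircle.injective_toCircle one_ne_zero).eq_iff]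

/-- A point of a finite-dimensional torus which is killed by every character that kills a subgroup
lies in the closure of that subgroup. -/
lemma mem_closure_of_forall_character {ι : Type*} [Fintype ι]
    (H : AddSubgroup (ι → UnitAddCircle)) (y : ι → UnitAddCircle)
    (hy : ∀ n : ι → ℤ, (∀ h ∈ H, ∑ i, n i • h i = 0) → ∑ i, n i • y i = 0) :
    y ∈ closure (H : Set (ι → UnitAddCircle)) := by
  by_contra hyH
  set C := H.topologicalClosure with hC
  have hCcl : IsClosed (C : Set (ι → UnitAddCircle)) := H.isClosed_topologicalClosure
  have : CompactSpace C := isCompact_iff_compactSpace.mp hCcl.isCompact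
  let μ : Measure C := Measure.addHaar
  have int_bdd : ∀ φ : C(ι → UnitAddCircle, ℂ), ∀ z,
      Integrable (fun c : C => φ (z + c)) μ := fun φ z =>
    (by fun_prop : Continuous fun c : C => φ (z + c)).integrable_of_hasCompactSupport
      (HasCompactSupport.of_compactSpace _)
  have hspan : ∀ P ∈ Submodule.span ℂ (Set.range (mFourier (d := ι))),
      ∫ c : C, P (y + c) ∂μ = ∫ c : C, P (0 + c) ∂μ := by
    intro P hP
    induction hP using Submodule.span_induction with
    | mem P hP =>
      obtain ⟨n, rfl⟩ := hP
      simp only [mFourier_add_apply, integral_const_mul]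
      by_cases hn : ∀ h ∈ H, ∑ i, n i • h i = 0
      · rw [(mFourier_apply_eq_one_iff n y).2 (hy n hn),
          (mFourier_apply_eq_one_iff n 0).2 (by simp)]
      · push Not at hn
        obtain ⟨h, hh, hne⟩ := hn
        have h1 : mFourier n h ≠ 1 := fun h' => hne ((mFourier_apply_eq_one_iff n h).1 h')
        have h2 := integral_add_left_eq_self (μ := μ) (fun c : C => mFourier n c)
          ⟨h, H.le_topologicalClosure hh⟩
        simp only [AddSubgroup.coe_add, mFourier_add_apply, integral_const_mul] at h2
        have h3 : ∫ c : C, mFourier n c ∂μ = 0 := by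
          by_contra h0
          exact h1 (mul_right_cancel₀ h0 (by rw [h2, one_mul]))
        rw [h3, mul_zero, mul_zero]
    | zero => simp
    | add P Q _ _ hP hQ =>
      simp only [ContinuousMap.add_apply]
      rw [integral_add (int_bdd P y) (int_bdd Q y), integral_add (int_bdd P 0) (int_bdd Q 0),
        hP, hQ]
    | smul a P _ hP =>
      simp only [ContinuousMap.smul_apply, integral_smul, hP]
  have hdisj : Disjoint (C : Set (ι → UnitAddCircle)) ((fun x => -y + x) ⁻¹' C) := by
    rw [Set.disjoint_left]
    intro x hx hx'
    have : y ∈ C := by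
      have := C.sub_mem hx hx'
      simpa using this
    exact hyH this
  obtain ⟨φ, hφ0, hφ1, -⟩ := exists_continuous_zero_one_of_isClosed hCcl
    (hCcl.preimage (by fun_prop)) hdisj
  let Φ : C(ι → UnitAddCircle, ℂ) := ⟨fun x => (φ x : ℂ), by fun_prop⟩
  have hΦ : Φ ∈ closure (Submodule.span ℂ (Set.range (mFourier (d := ι))) :
      Set C(ι → UnitAddCircle, ℂ)) := by
    have := span_mFourier_closure_eq_top (d := ι)
    rw [← Submodule.topologicalClosure_coe, this]; trivial
  obtain ⟨P, hP, hPd⟩ := Metric.mem_closure_iff.1 hΦ (1 / 4) (by norm_num)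
  have hb : ∀ x, ‖Φ x - P x‖ ≤ 1 / 4 := fun x =>
    (((Φ - P).norm_coe_le_norm x).trans (by rw [← dist_eq_norm]; exact hPd.le))
  have hsub : ∀ z, ∫ c : C, (Φ (z + c) - P (z + c)) ∂μ
      = ∫ c : C, Φ (z + c) ∂μ - ∫ c : C, P (z + c) ∂μ := fun z =>
    integral_sub (int_bdd Φ z) (int_bdd P z)
  have e0 : ∀ c : C, Φ (0 + c) = 0 := fun c => by
    have := hφ0 c.2
    simp [Φ, this]
  have e1 : ∀ c : C, Φ (y + c) = 1 := fun c => by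
    have := hφ1 (show y + (c : ι → UnitAddCircle) ∈ ((fun x => -y + x) ⁻¹' C) by simp)
    simp [Φ, this]
  have n0 := norm_integral_le_of_norm_le_const (μ := μ) (f := fun c : C => Φ (0 + c) - P (0 + c))
    (Eventually.of_forall fun c => hb _)
  have n1 := norm_integral_le_of_norm_le_const (μ := μ) (f := fun c : C => Φ (y + c) - P (y + c))
    (Eventually.of_forall fun c => hb _)
  rw [hsub] at n0 n1
  simp only [e0, e1, integral_zero, integral_const, hspan P hP] at n0 n1
  have hpos : 0 < μ.real Set.univ :=
    ENNReal.toReal_pos (by simp [μ, NeZero.ne]) (measure_ne_top _ _)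
  have := norm_sub_norm_le ((μ.real Set.univ) • (1 : ℂ)) (∫ c : C, P (0 + c) ∂μ)
  rw [zero_sub, norm_neg] at n0
  rw [norm_smul, Real.norm_of_nonneg hpos.le, norm_one] at this
  linarith

end Duality

lemma List.Lex.append_of_length_eq {α : Type*} {r : α → α → Prop} {s t : List α}
    (h : List.Lex r s t) (hl : s.length = t.length) (u : List α) :
    List.Lex r (s ++ u) (t ++ u) := by
  induction h with
  | nil => simp at hl
  | cons _ ih => exact List.Lex.cons (ih (by simpa using hl))
  | rel h => exact List.Lex.rel h

section Words

variable {G : Type*} [Group G] {S : Finset G}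

/-- The element of the group spelled by a word in the alphabet `S`. -/
def wordProd (w : List S) : G := (w.map Subtype.val).prod

@[simp] lemma wordProd_nil : wordProd ([] : List S) = 1 := by simp [wordProd]

@[simp] lemma wordProd_append (v w : List S) :
    wordProd (v ++ w) = wordProd v * wordProd w := by simp [wordProd]

variable (S) in
/-- A word is reduced if no shortlex-smaller word spells the same element. -/
def ReducedWord (w : List S) : Prop :=
  ∀ v : List S, wordProd v = wordProd w → ¬ List.Shortlex WellOrderingRel v w

lemma ReducedWord.eq_of_wordProd_eq {v w : List S} (hv : ReducedWord S v) (hw : ReducedWord S w)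
    (h : wordProd v = wordProd w) : v = w :=
  Std.Trichotomous.trichotomous (r := List.Shortlex (WellOrderingRel (α := S))) v w
    (hw v h) (hv w h.symm)

lemma reducedWord_nil : ReducedWord S [] := fun _ _ => List.not_shortlex_nil_right

lemma exists_reducedWord (w : List S) : ∃ v : List S, ReducedWord S v ∧ wordProd v = wordProd w := by
  have wf := List.Shortlex.wf (IsWellFounded.wf (r := WellOrderingRel (α := S)))
  obtain ⟨v, hv, hmin⟩ := wf.has_min {v : List S | wordProd v = wordProd w} ⟨w, rfl⟩
  exact ⟨v, fun u hu => hmin u (hu.trans hv), hv⟩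

lemma ReducedWord.of_append_left {u v : List S} (h : ReducedWord S (u ++ v)) :
    ReducedWord S u := by
  intro u' hu' hlt
  refine h (u' ++ v) (by simp [hu']) ?_
  rcases List.shortlex_def.1 hlt with hl | ⟨hl, hlex⟩
  · exact List.Shortlex.of_length_lt (by simpa using hl)
  · refine List.Shortlex.of_lex (by simp [hl]) ?_
    exact hlex.append_of_length_eq hl v

lemma ReducedWord.of_append_right {u v : List S} (h : ReducedWord S (u ++ v)) :
    ReducedWord S v := by
  intro v' hv' hlt
  exact h (u ++ v') (by simp [hv']) (hlt.append_left u)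

lemma ReducedWord.take {w : List S} (h : ReducedWord S w) (n : ℕ) : ReducedWord S (w.take n) := by
  rw [← List.take_append_drop n w] at h
  exact h.of_append_left

lemma ReducedWord.drop {w : List S} (h : ReducedWord S w) (n : ℕ) : ReducedWord S (w.drop n) := by
  rw [← List.take_append_drop n w] at h
  exact h.of_append_right

lemma ReducedWord.eq_nil {w : List S} (h : ReducedWord S w) (h1 : wordProd w = 1) : w = [] :=
  h.eq_of_wordProd_eq reducedWord_nil (by simpa using h1)

lemma exists_wordProd_eq (hinv : ∀ s ∈ S, s⁻¹ ∈ S) (hgen : Subgroup.closure (S : Set G) = ⊤)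
    (x : G) : ∃ w : List S, wordProd w = x := by
  have hx : x ∈ Subgroup.closure (S : Set G) := hgen ▸ Subgroup.mem_top x
  induction hx using Subgroup.closure_induction_left with
  | one => exact ⟨[], by simp⟩
  | mul_left s hs y _ ih =>
    obtain ⟨w, rfl⟩ := ih
    exact ⟨⟨s, hs⟩ :: w, by simp [wordProd]⟩
  | inv_mul_cancel s hs y _ ih =>
    obtain ⟨w, rfl⟩ := ih
    exact ⟨⟨s⁻¹, hinv s hs⟩ :: w, by simp [wordProd]⟩

lemma exists_reducedWord_length_eq [Infinite G] (hinv : ∀ s ∈ S, s⁻¹ ∈ S)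
    (hgen : Subgroup.closure (S : Set G) = ⊤) (n : ℕ) :
    ∃ w : List S, ReducedWord S w ∧ w.length = n := by
  by_contra! hcon
  have hlt : ∀ w : List S, ReducedWord S w → w.length < n := by
    intro w hw
    by_contra! hle
    exact hcon _ (hw.take n) (by simpa using hle)
  have hfin : Set.Finite (Set.univ : Set G) := by
    refine ((List.finite_length_lt S n).image wordProd).subset fun x _ => ?_
    obtain ⟨w, rfl⟩ := exists_wordProd_eq hinv hgen x
    obtain ⟨v, hv, hvw⟩ := exists_reducedWord w
    exact ⟨v, hlt v hv, hvw⟩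
  exact Set.infinite_univ hfin

/-- In an infinite finitely generated torsion group there are more than `n` reduced words of
length `n`: otherwise the Morse–Hedlund argument would produce reduced words with arbitrarily
long periodic factors. -/
lemma lt_ncard_reducedWord [Infinite G] (hinv : ∀ s ∈ S, s⁻¹ ∈ S)
    (hgen : Subgroup.closure (S : Set G) = ⊤) (htors : ∀ x : G, IsOfFinOrder x) (M : ℕ) :
    M < {w : List S | ReducedWord S w ∧ w.length = M}.ncard := by
  classical
  by_contra! hM
  obtain ⟨m, hm0, hm⟩ : ∃ m : ℕ, 0 < m ∧ ∀ v : List S, v.length ≤ M → wordProd v ^ m = 1 := by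
    have hfin := List.finite_length_le S M
    refine ⟨∏ v ∈ hfin.toFinset, orderOf (wordProd v),
      Finset.prod_pos fun v _ => (htors _).orderOf_pos, fun v hv => ?_⟩
    exact orderOf_dvd_iff_pow_eq_one.1
      (Finset.dvd_prod_of_mem (fun v => orderOf (wordProd v)) (by simpa using hv))
  set T := M + m * M with hT
  obtain ⟨w, hw, hlen⟩ := exists_reducedWord_length_eq hinv hgen (T + M)
  let fac : ℕ → ℕ → List S := fun k i => (w.drop i).take k
  let img : ℕ → Finset (List S) := fun k => (Finset.range (T + 1)).image (fac k)
  have himg : ∀ k l, k ≤ l → img k = (img l).image (List.take k) := by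
    intro k l hkl
    simp only [img, Finset.image_image]
    refine Finset.image_congr fun i _ => ?_
    simp [fac, List.take_take, hkl]
  have hcardM : (img M).card ≤ M := by
    refine le_trans ?_ hM
    rw [← Set.ncard_coe_finset]
    refine Set.ncard_le_ncard ?_ ((List.finite_length_eq S M).subset fun v hv => hv.2)
    intro v hv
    simp only [img, Finset.coe_image, Set.mem_image, Finset.coe_range, Set.mem_Iio] at hv
    obtain ⟨i, hi, rfl⟩ := hv
    exact ⟨(hw.drop i).take M, by simp [fac, hlen]; omega⟩
  obtain ⟨k, hkM, hk⟩ : ∃ k < M, (img (k + 1)).card ≤ (img k).card := by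
    by_contra! hcon
    have : ∀ j ≤ M, j + 1 ≤ (img j).card := by
      intro j
      induction j with
      | zero => intro _; exact Finset.card_pos.2 ⟨fac 0 0, Finset.mem_image_of_mem _ (by simp)⟩
      | succ j ih => intro hj; have := ih (by omega); have := hcon j (by omega); omega
    have := this M le_rfl
    omega
  have hinj : ∀ i j, i ≤ T → j ≤ T → fac k i = fac k j → fac (k + 1) i = fac (k + 1) j := by
    have h1 : Set.InjOn (List.take k) (img (k + 1) : Set (List S)) := by
      rw [← Finset.card_image_iff, ← himg k (k + 1) (by omega)]
      refine le_antisymm ?_ hk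
      rw [himg k (k + 1) (by omega)]
      exact Finset.card_image_le
    intro i j hi hj hij
    refine h1 (Finset.mem_coe.2 (Finset.mem_image_of_mem _ (by simpa using by omega)))
      (Finset.mem_coe.2 (Finset.mem_image_of_mem _ (by simpa using by omega))) ?_
    simpa [fac, List.take_take] using hij
  obtain ⟨i, j, hij, hjM, hfac⟩ : ∃ i j, i < j ∧ j ≤ M ∧ fac k i = fac k j := by
    have hlt : (img k).card < (Finset.range (M + 1)).card := by
      rw [himg k M hkM.le, Finset.card_range]
      exact Nat.lt_succ_of_le (Finset.card_image_le.trans hcardM)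
    obtain ⟨a, ha, b, hb, hab, h⟩ := Finset.exists_ne_map_eq_of_card_lt_of_maps_to hlt
      (f := fac k) (fun a ha => Finset.mem_image_of_mem _ (by
        simp only [Finset.coe_range, Set.mem_Iio] at ha
        simp only [Finset.mem_range]
        omega))
    simp only [Finset.mem_range] at ha hb
    rcases lt_or_gt_of_ne hab with h' | h'
    · exact ⟨a, b, h', by omega, h⟩
    · exact ⟨b, a, h', by omega, h.symm⟩
  have hshift : ∀ l, j + l ≤ T → fac k (i + l) = fac k (j + l) := by
    intro l
    induction l with
    | zero => intro _; exact hfac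
    | succ l ih =>
      intro hl
      have h1 := hinj _ _ (by omega) (by omega) (ih (by omega))
      have h2 := congrArg List.tail h1
      have htail : ∀ a, (fac (k + 1) a).tail = fac k (a + 1) := by
        intro a
        simp [fac, ← List.drop_one, List.drop_take, List.drop_drop]
      rwa [htail, htail] at h2
  have hletter : ∀ l, j + l ≤ T → w[i + l]? = w[j + l]? := by
    intro l hl
    have h1 := congrArg (fun v => v[0]?) (hinj _ _ (by omega) (by omega) (hshift l hl))
    simpa [fac, List.getElem?_take, List.getElem?_drop] using h1
  set d := j - i with hd
  have hper : ∀ a, j + a * d ≤ T + 1 → fac (a * d) (i + d) = fac (a * d) i := by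
    intro a ha
    refine List.ext_getElem? fun l => ?_
    simp only [fac, List.getElem?_take, List.getElem?_drop]
    split_ifs with hl
    · rw [hletter l (by omega), show i + d + l = j + l by omega]
    · rfl
  have hpow : ∀ a, j + a * d ≤ T + 1 → wordProd (fac (a * d) i) = wordProd (fac d i) ^ a := by
    intro a
    induction a with
    | zero => intro _; simp [fac]
    | succ a ih =>
      intro ha
      have ha' : j + a * d ≤ T + 1 := by rw [Nat.succ_mul] at ha; omega
      have hsplit : fac ((a + 1) * d) i = fac d i ++ fac (a * d) (i + d) := by
        simp only [fac]
        rw [show (a + 1) * d = d + a * d by ring, List.take_add, List.drop_drop]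
      rw [hsplit, wordProd_append, hper a ha', ih ha', pow_succ']
  have hmd : m * d ≤ m * M := Nat.mul_le_mul_left _ (by omega)
  have h1 := hpow m (by omega)
  rw [hm _ (by simp [fac]; omega)] at h1
  have h2 := ((hw.drop i).take (m * d)).eq_nil h1
  have h3 := congrArg List.length h2
  have hmd' : 0 < m * d := Nat.mul_pos hm0 (by omega)
  simp [hlen] at h3
  omega

end Words

section Growth

open scoped Pointwise

variable {G : Type*} [Group G] [DecidableEq G] {S : Finset G}

lemma wordProd_mem_pow (h1 : 1 ∈ S) (w : List S) {n : ℕ} (hn : w.length ≤ n) :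
    wordProd w ∈ S ^ n := by
  refine Finset.pow_subset_pow_right h1 hn ?_
  clear hn
  induction w with
  | nil => simp
  | cons s w ih =>
    rw [List.length_cons, pow_succ']
    exact Finset.mul_mem_mul s.2 ih

lemma exists_mem_pow (h1 : 1 ∈ S) (hinv : ∀ s ∈ S, s⁻¹ ∈ S)
    (hgen : Subgroup.closure (S : Set G) = ⊤) (x : G) : ∃ n, x ∈ S ^ n := by
  obtain ⟨w, rfl⟩ := exists_wordProd_eq hinv hgen x
  exact ⟨w.length, wordProd_mem_pow h1 w le_rfl⟩

lemma sum_ncard_reducedWord_le_card_pow (h1 : 1 ∈ S) (n : ℕ) :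
    ∑ k ∈ Finset.range (n + 1), {w : List S | ReducedWord S w ∧ w.length = k}.ncard ≤
      (S ^ n).card := by
  have hfin : ∀ k, {w : List S | ReducedWord S w ∧ w.length = k}.Finite := fun k =>
    (List.finite_length_eq S k).subset fun v hv => hv.2
  simp_rw [fun k => Set.ncard_eq_toFinset_card _ (hfin k)]
  classical
  rw [← Finset.card_biUnion]
  · refine Finset.card_le_card_of_injOn wordProd ?_ ?_
    · intro w hw
      simp only [Finset.coe_biUnion, Set.mem_iUnion, Finset.mem_coe, Set.Finite.mem_toFinset,
        Set.mem_ofPred_eq, Finset.mem_range] at hw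
      obtain ⟨k, hk, -, hl⟩ := hw
      exact wordProd_mem_pow h1 w (by omega)
    · intro v hv w hw h
      simp only [Finset.coe_biUnion, Set.mem_iUnion, Finset.mem_coe, Set.Finite.mem_toFinset,
        Set.mem_ofPred_eq] at hv hw
      obtain ⟨_, _, hv, _⟩ := hv
      obtain ⟨_, _, hw, _⟩ := hw
      exact hv.eq_of_wordProd_eq hw h
  · intro a _ b _ hab
    refine Finset.disjoint_left.2 fun w hw hw' => hab ?_
    simp only [Set.Finite.mem_toFinset, Set.mem_ofPred_eq] at hw hw'
    omega

lemma sq_le_card_pow_of_torsion [Infinite G] (h1 : 1 ∈ S) (hinv : ∀ s ∈ S, s⁻¹ ∈ S)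
    (hgen : Subgroup.closure (S : Set G) = ⊤) (htors : ∀ x : G, IsOfFinOrder x) (n : ℕ) :
    n ^ 2 ≤ 2 * (S ^ n).card := by
  have h2 : ∑ k ∈ Finset.range (n + 1), (k + 1) ≤ (S ^ n).card :=
    (Finset.sum_le_sum fun k _ => lt_ncard_reducedWord hinv hgen htors k).trans
      (sum_ncard_reducedWord_le_card_pow h1 n)
  have h3 : ∀ n : ℕ, n ^ 2 ≤ 2 * ∑ k ∈ Finset.range (n + 1), (k + 1) := by
    intro n
    induction n with
    | zero => simp
    | succ n ih => rw [Finset.sum_range_succ]; nlinarith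
  exact (h3 n).trans (by omega)

/-- Balls of radius `n` meet more than `n` left cosets of a subgroup of infinite index. -/
lemma lt_card_image_mk_pow (H : Subgroup G) [Infinite (G ⧸ H)] [DecidableEq (G ⧸ H)] (h1 : 1 ∈ S)
    (hinv : ∀ s ∈ S, s⁻¹ ∈ S) (hgen : Subgroup.closure (S : Set G) = ⊤) (n : ℕ) :
    n < ((S ^ n).image (QuotientGroup.mk : G → G ⧸ H)).card := by
  have hmono : ∀ n, (S ^ n).image (QuotientGroup.mk : G → G ⧸ H) ⊆
      (S ^ (n + 1)).image QuotientGroup.mk := fun n =>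
    Finset.image_subset_image (Finset.pow_subset_pow_right h1 (Nat.le_succ n))
  have hne : ∀ n, (S ^ n).image (QuotientGroup.mk : G → G ⧸ H) ≠
      (S ^ (n + 1)).image QuotientGroup.mk := by
    intro n heq
    have hstep : ∀ y ∈ (S ^ n).image (QuotientGroup.mk : G → G ⧸ H), ∀ s ∈ S,
        s • y ∈ (S ^ n).image (QuotientGroup.mk : G → G ⧸ H) := by
      intro y hy s hs
      obtain ⟨x, hx, rfl⟩ := Finset.mem_image.1 hy
      rw [heq, pow_succ']
      exact Finset.mem_image.2 ⟨s * x, Finset.mul_mem_mul hs hx, rfl⟩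
    have hall : ∀ x : G, (x : G ⧸ H) ∈ (S ^ n).image (QuotientGroup.mk : G → G ⧸ H) := by
      intro x
      obtain ⟨w, rfl⟩ := exists_wordProd_eq hinv hgen x
      induction w with
      | nil =>
        exact Finset.mem_image_of_mem _ (by simpa using Finset.one_mem_pow h1)
      | cons s w ih => exact hstep _ ih s s.2
    refine Set.infinite_univ (α := G ⧸ H) (((S ^ n).image QuotientGroup.mk).finite_toSet.subset ?_)
    intro y _
    induction y using QuotientGroup.induction_on with
    | H x => exact hall x
  induction n with
  | zero => simp
  | succ n ih =>
    exact lt_of_le_of_lt ih (Finset.card_lt_card ((hmono n).ssubset_of_ne (hne n)))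

lemma card_pow_of_not_isOfFinOrder {u : G} (hu : ¬ IsOfFinOrder u)
    [Infinite (G ⧸ Subgroup.zpowers u)] (h1 : 1 ∈ S)
    (hinv : ∀ s ∈ S, s⁻¹ ∈ S) (hgen : Subgroup.closure (S : Set G) = ⊤) {k : ℕ} (hk : u ∈ S ^ k)
    (n : ℕ) : (n + 1) ^ 2 ≤ (S ^ ((k + 1) * n)).card := by
  classical
  let π : G → G ⧸ Subgroup.zpowers u := QuotientGroup.mk
  have hinj : Function.Injective (fun i : ℕ => u ^ i) :=
    injective_pow_iff_not_isOfFinOrder.2 hu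
  have hsec : ∀ y ∈ (S ^ n).image π, ∃ x ∈ S ^ n, π x = y := fun y hy => Finset.mem_image.1 hy
  choose! σ hσ hπσ using hsec
  have hcard : ((((S ^ n).image π) ×ˢ Finset.range (n + 1)).card) ≤ (S ^ ((k + 1) * n)).card := by
    refine Finset.card_le_card_of_injOn (fun z => σ z.1 * u ^ z.2) ?_ ?_
    · rintro ⟨y, i⟩ hz
      simp only [Finset.coe_product, Set.mem_prod, Finset.mem_coe, Finset.mem_range] at hz
      have e : (k + 1) * n = n + k * n := by ring
      rw [e, pow_add, pow_mul]
      refine Finset.mul_mem_mul (hσ y hz.1) ?_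
      refine Finset.pow_subset_pow_right (Finset.one_mem_pow h1) (Nat.lt_succ_iff.1 hz.2) ?_
      exact Finset.pow_mem_pow hk
    · rintro ⟨y, i⟩ hz ⟨y', i'⟩ hz' h
      simp only [Finset.coe_product, Set.mem_prod, Finset.mem_coe, Finset.mem_range] at hz hz' h
      have hy : y = y' := by
        rw [← hπσ y hz.1, ← hπσ y' hz'.1]
        have a1 : ∀ (x : G) (j : ℕ), π (x * u ^ j) = π x := fun x j =>
          QuotientGroup.mk_mul_of_mem x (Subgroup.pow_mem _ (Subgroup.mem_zpowers u) j)
        rw [← a1 (σ y) i, h, a1]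
      subst hy
      have := hinj (mul_left_cancel h)
      simp_all
  rw [Finset.card_product, Finset.card_range] at hcard
  have := lt_card_image_mk_pow (Subgroup.zpowers u) h1 hinv hgen n
  refine le_trans ?_ hcard
  rw [sq]
  exact Nat.mul_le_mul_right _ this

/-- A finitely generated infinite group without a finite-index infinite cyclic normal subgroup
has at least quadratic growth. -/
theorem exists_quadratic_le_card_pow [Infinite G]
    (hZ : ∀ N : Subgroup G, N.Normal → N.FiniteIndex → IsEmpty (N ≃* Multiplicative ℤ))
    (h1 : 1 ∈ S) (hinv : ∀ s ∈ S, s⁻¹ ∈ S) (hgen : Subgroup.closure (S : Set G) = ⊤) :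
    ∃ c : ℝ, 0 < c ∧ ∀ n : ℕ, c * (n : ℝ) ^ 2 ≤ (S ^ n).card := by
  by_cases htors : ∀ x : G, IsOfFinOrder x
  · refine ⟨1 / 2, by norm_num, fun n => ?_⟩
    have := sq_le_card_pow_of_torsion h1 hinv hgen htors n
    have h : ((n ^ 2 : ℕ) : ℝ) ≤ ((2 * (S ^ n).card : ℕ) : ℝ) := Nat.cast_le.2 this
    push_cast at h
    linarith
  · push Not at htors
    obtain ⟨u, hu⟩ := htors
    have hinf : Infinite (G ⧸ Subgroup.zpowers u) := by
      by_contra hfin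
      rw [not_infinite_iff_finite] at hfin
      have hfi : (Subgroup.zpowers u).FiniteIndex := Subgroup.finiteIndex_of_finite_quotient
      let N := (Subgroup.zpowers u).normalCore
      have hNfi : N.FiniteIndex := inferInstance
      have hNle : N ≤ Subgroup.zpowers u := Subgroup.normalCore_le _
      have hNinf : Infinite N := by
        by_contra hf
        rw [not_infinite_iff_finite] at hf
        have : Finite G := by
          have : Finite (G ⧸ N) := Subgroup.finite_quotient_of_finiteIndex
          exact Finite.of_equiv _ (Subgroup.groupEquivQuotientProdSubgroup (s := N)).symm
        exact not_finite G
      have hcyc : IsCyclic N := by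
        exact isCyclic_of_injective (Subgroup.inclusion hNle) (Subgroup.inclusion_injective hNle)
      exact (hZ N inferInstance hNfi).false
        (mulEquivOfCyclicCardEq (by simp [Nat.card_eq_zero_of_infinite]))
    obtain ⟨k, hk⟩ := exists_mem_pow h1 hinv hgen u
    refine ⟨1 / ((k : ℝ) + 1) ^ 2, by positivity, fun n => ?_⟩
    have h2 := card_pow_of_not_isOfFinOrder hu h1 hinv hgen hk (n / (k + 1))
    have h3 : (S ^ ((k + 1) * (n / (k + 1)))).card ≤ (S ^ n).card :=
      Finset.card_le_card (Finset.pow_subset_pow_right h1 (Nat.mul_div_le n (k + 1)))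
    have h4 : n ≤ (k + 1) * (n / (k + 1) + 1) := (Nat.lt_mul_div_succ n (Nat.succ_pos k)).le
    have h5 : n ^ 2 ≤ (k + 1) ^ 2 * (S ^ n).card :=
      calc n ^ 2 ≤ ((k + 1) * (n / (k + 1) + 1)) ^ 2 := Nat.pow_le_pow_left h4 2
        _ = (k + 1) ^ 2 * (n / (k + 1) + 1) ^ 2 := by ring
        _ ≤ _ := Nat.mul_le_mul_left _ (h2.trans h3)
    have h6 : ((n ^ 2 : ℕ) : ℝ) ≤ (((k + 1) ^ 2 * (S ^ n).card : ℕ) : ℝ) := Nat.cast_le.2 h5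
    push_cast at h6
    rw [div_mul_eq_mul_div, one_mul, div_le_iff₀ (by positivity)]
    linarith

end Growth

section Convolution

open MonoidAlgebra

variable {G : Type*} [Group G]

/-- The involution `x ↦ x⁻¹` of the group, extended linearly to the group ring. -/
noncomputable def convFlip (a : MonoidAlgebra ℝ G) : MonoidAlgebra ℝ G :=
  ofCoeff (a.coeff.equivMapDomain (Equiv.inv G))

@[simp] lemma coeff_convFlip (a : MonoidAlgebra ℝ G) (x : G) :
    (convFlip a).coeff x = a.coeff x⁻¹ := by
  simp [convFlip]

lemma convFlip_convFlip (a : MonoidAlgebra ℝ G) : convFlip (convFlip a) = a := by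
  ext x; simp

lemma convFlip_zero : convFlip (0 : MonoidAlgebra ℝ G) = 0 := by
  ext x; simp

lemma convFlip_add (a b : MonoidAlgebra ℝ G) : convFlip (a + b) = convFlip a + convFlip b := by
  ext x; simp

lemma convFlip_smul (r : ℝ) (a : MonoidAlgebra ℝ G) : convFlip (r • a) = r • convFlip a := by
  ext x; simp

lemma convFlip_single (x : G) (r : ℝ) : convFlip (single x r) = single x⁻¹ r := by
  classical
  ext y
  simp [Finsupp.single_apply, inv_eq_iff_eq_inv]

lemma convFlip_mul (a b : MonoidAlgebra ℝ G) : convFlip (a * b) = convFlip b * convFlip a := by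
  induction a using MonoidAlgebra.induction_linear with
  | zero => simp [convFlip_zero]
  | add a a' ha ha' => rw [add_mul, convFlip_add, convFlip_add, mul_add, ha, ha']
  | single x r =>
    induction b using MonoidAlgebra.induction_linear with
    | zero => simp [convFlip_zero]
    | add b b' hb hb' => rw [mul_add, convFlip_add, convFlip_add, add_mul, hb, hb']
    | single y s => simp [convFlip_single, single_mul_single, mul_comm]

lemma convFlip_pow {p : MonoidAlgebra ℝ G} (hp : convFlip p = p) (n : ℕ) :
    convFlip (p ^ n) = p ^ n := by
  induction n with
  | zero => simp [one_def, convFlip_single]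
  | succ n ih => rw [pow_succ, convFlip_mul, ih, hp, ← pow_succ', pow_succ]

/-- The squared `ℓ²`-norm on the group ring. -/
noncomputable def convNormSq (a : MonoidAlgebra ℝ G) : ℝ := (convFlip a * a).coeff 1

lemma convNormSq_nonneg (a : MonoidAlgebra ℝ G) : 0 ≤ convNormSq a := by
  rw [convNormSq, coeff_mul_apply_left]
  refine Finset.sum_nonneg fun x _ => ?_
  simp only [coeff_convFlip, mul_one]
  exact mul_self_nonneg _

lemma coeff_convFlip_mul_comm (a b : MonoidAlgebra ℝ G) :
    (convFlip a * b).coeff 1 = (convFlip b * a).coeff 1 := by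
  have := coeff_convFlip (convFlip a * b) 1
  rw [convFlip_mul, convFlip_convFlip, inv_one] at this
  exact this.symm

lemma convNormSq_add_smul (a b : MonoidAlgebra ℝ G) (r : ℝ) :
    convNormSq (a + r • b) =
      convNormSq a + 2 * r * (convFlip a * b).coeff 1 + r ^ 2 * convNormSq b := by
  simp only [convNormSq, convFlip_add, convFlip_smul, add_mul, mul_add, smul_mul_assoc,
    mul_smul_comm, coeff_add, coeff_smul, Finsupp.add_apply, Finsupp.smul_apply, smul_eq_mul]
  rw [coeff_convFlip_mul_comm b a]
  ring

lemma sq_coeff_convFlip_mul_le (a b : MonoidAlgebra ℝ G) :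
    (convFlip a * b).coeff 1 ^ 2 ≤ convNormSq a * convNormSq b := by
  have h : ∀ r : ℝ, 0 ≤ convNormSq b * (r * r) + 2 * (convFlip a * b).coeff 1 * r
      + convNormSq a := by
    intro r
    have := convNormSq_nonneg (a + r • b)
    rw [convNormSq_add_smul] at this
    linarith
  have := discrim_le_zero h
  rw [discrim] at this
  linarith

lemma convNormSq_add_le (a b : MonoidAlgebra ℝ G) {r : ℝ} (hr : 0 < r) :
    convNormSq (a + b) ≤ (1 + 1 / r) * convNormSq a + (1 + r) * convNormSq b := by
  have h1 := convNormSq_add_smul a b 1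
  have h2 := convNormSq_nonneg (a + (-r) • b)
  rw [convNormSq_add_smul] at h2
  rw [one_smul] at h1
  have h3 : 2 * (convFlip a * b).coeff 1 ≤ 1 / r * convNormSq a + r * convNormSq b := by
    have : 0 ≤ 1 / r * (convNormSq a + 2 * -r * (convFlip a * b).coeff 1
      + (-r) ^ 2 * convNormSq b) := by positivity
    have e : 1 / r * (convNormSq a + 2 * -r * (convFlip a * b).coeff 1 + (-r) ^ 2 * convNormSq b)
      = 1 / r * convNormSq a - 2 * (convFlip a * b).coeff 1 + r * convNormSq b := by
      field_simp
      ring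
    linarith
  linarith

lemma convNormSq_mul_single (a : MonoidAlgebra ℝ G) (x : G) :
    convNormSq (a * single x 1) = convNormSq a := by
  rw [convNormSq, convFlip_mul, convFlip_single, mul_assoc, ← mul_assoc (convFlip a),
    coeff_single_mul_apply, coeff_mul_single_apply]
  simp [convNormSq]

lemma sq_coeff_mul_le (a b : MonoidAlgebra ℝ G) (x : G) :
    (a * b).coeff x ^ 2 ≤ convNormSq (convFlip a) * convNormSq b := by
  have h := sq_coeff_convFlip_mul_le (convFlip a) (b * single x⁻¹ 1)
  rw [convNormSq_mul_single, convFlip_convFlip, ← mul_assoc, coeff_mul_single_apply] at h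
  simpa using h

end Convolution

section Walk

open MonoidAlgebra
open scoped Pointwise

variable {G : Type*} [Group G]

/-- The density of a lazy symmetric random walk with finite set of steps `S`. -/
structure IsLazyWalk (S : Finset G) (p : MonoidAlgebra ℝ G) : Prop where
  nonneg : ∀ x, 0 ≤ p.coeff x
  support_eq : p.coeff.support = S
  one_mem : 1 ∈ S
  flip_eq : convFlip p = p
  sum_eq_one : ∑ s ∈ S, p.coeff s = 1

lemma coeff_one_apply [DecidableEq G] (x : G) :
    (1 : MonoidAlgebra ℝ G).coeff x = if x = 1 then 1 else 0 := by
  simp [one_def, Finsupp.single_apply, eq_comm]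

lemma convNormSq_translate_sub (a : MonoidAlgebra ℝ G) (t : G) :
    convNormSq (a * single t⁻¹ 1 - a) = 2 * (convNormSq a - (convFlip a * a).coeff t) := by
  have h := convNormSq_add_smul (a * single t⁻¹ 1) a (-1)
  rw [convNormSq_mul_single, coeff_convFlip_mul_comm, ← mul_assoc, coeff_mul_single_apply] at h
  rw [neg_smul, one_smul, ← sub_eq_add_neg] at h
  rw [h]
  simp
  ring

lemma convNormSq_translate_sub_le [DecidableEq G] {S : Finset G} (a : MonoidAlgebra ℝ G) {M : ℝ}
    (hM : ∀ s ∈ S, convNormSq (a * single s⁻¹ 1 - a) ≤ M) (r : ℕ) :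
    ∀ t ∈ S ^ r, convNormSq (a * single t⁻¹ 1 - a) ≤ r ^ 2 * M := by
  induction r with
  | zero =>
    intro t ht
    have : t = 1 := by simpa using ht
    subst this
    simp [convNormSq, convFlip_zero, ← one_def]
  | succ r ih =>
    intro t ht
    rw [pow_succ] at ht
    obtain ⟨u, hu, s, hs, rfl⟩ := Finset.mem_mul.1 ht
    have e : a * single (u * s)⁻¹ 1 - a =
        (a * single u⁻¹ 1 - a) + (a * single s⁻¹ 1 - a) * single u⁻¹ 1 := by
      rw [sub_mul, mul_assoc a, single_mul_single, mul_inv_rev, one_mul]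
      abel
    rcases Nat.eq_zero_or_pos r with rfl | hr
    · have : u = 1 := by simpa using hu
      subst this
      simpa using hM s hs
    · have hr' : (0 : ℝ) < r := by exact_mod_cast hr
      rw [e]
      refine (convNormSq_add_le _ _ hr').trans ?_
      rw [convNormSq_mul_single]
      calc _ ≤ (1 + 1 / (r : ℝ)) * (r ^ 2 * M) + (1 + r) * M := by
            gcongr
            · exact ih u hu
            · exact hM s hs
        _ = _ := by
            push_cast
            field_simp
            ring

namespace IsLazyWalk

variable {S : Finset G} {p : MonoidAlgebra ℝ G} (hp : IsLazyWalk S p)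
include hp

lemma pos {s : G} (hs : s ∈ S) : 0 < p.coeff s := by
  refine lt_of_le_of_ne (hp.nonneg s) (Ne.symm ?_)
  rw [← hp.support_eq] at hs
  exact Finsupp.mem_support_iff.1 hs

lemma coeff_inv (x : G) : p.coeff x⁻¹ = p.coeff x := by
  rw [← coeff_convFlip, hp.flip_eq]

lemma inv_mem {s : G} (hs : s ∈ S) : s⁻¹ ∈ S := by
  rw [← hp.support_eq, Finsupp.mem_support_iff, hp.coeff_inv]
  exact (hp.pos hs).ne'

lemma coeff_pow_inv (n : ℕ) (x : G) : (p ^ n).coeff x⁻¹ = (p ^ n).coeff x := by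
  rw [← coeff_convFlip, convFlip_pow hp.flip_eq]

lemma coeff_mul_eq_sum (a : MonoidAlgebra ℝ G) (x : G) :
    (p * a).coeff x = ∑ s ∈ S, p.coeff s * a.coeff (s⁻¹ * x) := by
  rw [coeff_mul_apply_left, Finsupp.sum, hp.support_eq]

lemma coeff_pow_succ_eq_sum_right (n : ℕ) (x : G) :
    (p ^ (n + 1)).coeff x = ∑ s ∈ S, p.coeff s * (p ^ n).coeff (x * s) := by
  rw [← hp.coeff_pow_inv, pow_succ', hp.coeff_mul_eq_sum]
  refine Finset.sum_congr rfl fun s _ => ?_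
  rw [← hp.coeff_pow_inv n (x * s), mul_inv_rev]

lemma coeff_pow_nonneg (n : ℕ) (x : G) : 0 ≤ (p ^ n).coeff x := by
  induction n generalizing x with
  | zero => classical rw [pow_zero, coeff_one_apply]; split_ifs <;> norm_num
  | succ n ih =>
    rw [pow_succ', hp.coeff_mul_eq_sum]
    exact Finset.sum_nonneg fun s _ => mul_nonneg (hp.nonneg s) (ih _)

lemma sum_coeff_pow_le_one (n : ℕ) (T : Finset G) : ∑ x ∈ T, (p ^ n).coeff x ≤ 1 := by
  classical
  induction n generalizing T with
  | zero =>
    simp only [pow_zero, coeff_one_apply, Finset.sum_ite_eq']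
    split_ifs <;> norm_num
  | succ n ih =>
    simp only [pow_succ', hp.coeff_mul_eq_sum]
    rw [Finset.sum_comm, ← hp.sum_eq_one]
    refine Finset.sum_le_sum fun s _ => ?_
    rw [← Finset.mul_sum]
    refine mul_le_of_le_one_right (hp.nonneg s) ?_
    have := ih (T.image (s⁻¹ * ·))
    rwa [Finset.sum_image (by simp)] at this

lemma convNormSq_pow (n : ℕ) : convNormSq (p ^ n) = (p ^ (2 * n)).coeff 1 := by
  rw [convNormSq, convFlip_pow hp.flip_eq, ← pow_add, two_mul]

lemma convNormSq_pow_translate_sub (n : ℕ) (t : G) :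
    convNormSq (p ^ n * single t⁻¹ 1 - p ^ n) =
      2 * ((p ^ (2 * n)).coeff 1 - (p ^ (2 * n)).coeff t) := by
  rw [convNormSq_translate_sub, hp.convNormSq_pow, convFlip_pow hp.flip_eq, ← pow_add, ← two_mul n]

lemma coeff_pow_even_le (n : ℕ) (x : G) : (p ^ (2 * n)).coeff x ≤ (p ^ (2 * n)).coeff 1 := by
  have := convNormSq_nonneg (p ^ n * single x⁻¹ 1 - p ^ n)
  rw [hp.convNormSq_pow_translate_sub] at this
  linarith

lemma coeff_pow_odd_le (n : ℕ) (x : G) : (p ^ (2 * n + 1)).coeff x ≤ (p ^ (2 * n)).coeff 1 := by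
  rw [hp.coeff_pow_succ_eq_sum_right]
  calc _ ≤ ∑ s ∈ S, p.coeff s * (p ^ (2 * n)).coeff 1 := by
        gcongr with s _
        · exact hp.nonneg s
        · exact hp.coeff_pow_even_le n _
    _ = _ := by rw [← Finset.sum_mul, hp.sum_eq_one, one_mul]

lemma mul_coeff_sub_le (n : ℕ) {s : G} (hs : s ∈ S) :
    p.coeff s * p.coeff 1 * ((p ^ (2 * n)).coeff 1 - (p ^ (2 * n)).coeff s) ≤
      (p ^ (2 * n)).coeff 1 - (p ^ (2 * (n + 1))).coeff 1 := by
  have e : (p ^ (2 * n)).coeff 1 - (p ^ (2 * (n + 1))).coeff 1 =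
      ∑ u ∈ S, ∑ v ∈ S, p.coeff u * p.coeff v *
        ((p ^ (2 * n)).coeff 1 - (p ^ (2 * n)).coeff (u * v)) := by
    have h : (p ^ (2 * (n + 1))).coeff 1 =
        ∑ u ∈ S, ∑ v ∈ S, p.coeff u * p.coeff v * (p ^ (2 * n)).coeff (u * v) := by
      rw [show 2 * (n + 1) = 2 * n + 1 + 1 by ring, hp.coeff_pow_succ_eq_sum_right]
      refine Finset.sum_congr rfl fun u _ => ?_
      rw [hp.coeff_pow_succ_eq_sum_right, Finset.mul_sum]
      simp only [one_mul, mul_assoc]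
    simp only [mul_sub, Finset.sum_sub_distrib, ← h]
    simp only [← Finset.sum_mul, ← Finset.mul_sum, hp.sum_eq_one, mul_one, one_mul]
  have hnn : ∀ u v, 0 ≤ p.coeff u * p.coeff v *
      ((p ^ (2 * n)).coeff 1 - (p ^ (2 * n)).coeff (u * v)) := fun u v =>
    mul_nonneg (mul_nonneg (hp.nonneg u) (hp.nonneg v)) (sub_nonneg.2 (hp.coeff_pow_even_le n _))
  rw [e]
  refine le_trans ?_ (Finset.single_le_sum
    (f := fun u => ∑ v ∈ S, p.coeff u * p.coeff v *
      ((p ^ (2 * n)).coeff 1 - (p ^ (2 * n)).coeff (u * v)))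
    (fun u _ => Finset.sum_nonneg fun v _ => hnn u v) hs)
  refine le_trans ?_ (Finset.single_le_sum
    (f := fun v => p.coeff s * p.coeff v *
      ((p ^ (2 * n)).coeff 1 - (p ^ (2 * n)).coeff (s * v)))
    (fun v _ => hnn s v) hp.one_mem)
  simp

lemma exists_coeff_sub_le : ∃ C : ℝ, 0 < C ∧ ∀ n : ℕ, ∀ s ∈ S,
    convNormSq (p ^ n * single s⁻¹ 1 - p ^ n) ≤
      C * ((p ^ (2 * n)).coeff 1 - (p ^ (2 * (n + 1))).coeff 1) := by
  obtain ⟨s₀, hs₀, hmin⟩ := S.exists_min_image (fun s => p.coeff s) ⟨1, hp.one_mem⟩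
  have h0 := hp.pos hs₀
  have h1 := hp.pos hp.one_mem
  refine ⟨2 / (p.coeff s₀ * p.coeff 1), by positivity, fun n s hs => ?_⟩
  rw [hp.convNormSq_pow_translate_sub, div_mul_eq_mul_div, le_div_iff₀ (by positivity)]
  have h2 := hp.mul_coeff_sub_le n hs
  have h3 := sub_nonneg.2 (hp.coeff_pow_even_le n s)
  have h4 := mul_le_mul_of_nonneg_right (hmin s hs) (mul_nonneg h1.le h3)
  linarith

lemma coeff_pow_even_antitone : Antitone fun n : ℕ => (p ^ (2 * n)).coeff 1 := by
  refine antitone_nat_of_succ_le fun n => ?_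
  have := hp.mul_coeff_sub_le n hp.one_mem
  simp only [sub_self, mul_zero] at this
  linarith

lemma sq_coeff_translate_sub_le (n : ℕ) (t x : G) :
    ((p ^ (2 * n)).coeff (x * t) - (p ^ (2 * n)).coeff x) ^ 2 ≤
      (p ^ (2 * n)).coeff 1 * convNormSq (p ^ n * single t⁻¹ 1 - p ^ n) := by
  have h := sq_coeff_mul_le (p ^ n) (p ^ n * single t⁻¹ 1 - p ^ n) x
  rw [convFlip_pow hp.flip_eq, hp.convNormSq_pow, mul_sub, ← mul_assoc, ← pow_add, ← two_mul,
    coeff_sub, Finsupp.sub_apply, coeff_mul_single_apply] at h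
  simpa using h

/-- Nash-type inequality for a lazy walk on a group of at least quadratic growth. -/
lemma exists_sq_coeff_le [DecidableEq G] {c : ℝ} (hc : 0 < c)
    (hgrow : ∀ n : ℕ, c * (n : ℝ) ^ 2 ≤ (S ^ n).card) :
    ∃ D : ℝ, 0 < D ∧ ∀ n : ℕ, (p ^ (2 * n)).coeff 1 ^ 2 ≤
      D * ((p ^ (2 * n)).coeff 1 - (p ^ (2 * (n + 1))).coeff 1) := by
  obtain ⟨C, hC, hCn⟩ := hp.exists_coeff_sub_le
  refine ⟨2 * (2 / c + 1) * C, by positivity, fun n => ?_⟩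
  set q := (p ^ (2 * n)).coeff 1 with hq
  set d := q - (p ^ (2 * (n + 1))).coeff 1 with hd
  have hd0 : 0 ≤ d := sub_nonneg.2 (hp.coeff_pow_even_antitone n.le_succ)
  have hq0 : 0 ≤ q := hp.coeff_pow_nonneg _ _
  have hq1 : q ≤ 1 := by simpa using hp.sum_coeff_pow_le_one (2 * n) {1}
  rcases hq0.eq_or_lt with h0 | hqpos
  · rw [← h0, zero_pow two_ne_zero]; positivity
  have hball : ∀ r : ℕ, ((S ^ r).card : ℝ) * (q - r ^ 2 * (C * d) / 2) ≤ 1 := by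
    intro r
    refine le_trans ?_ (hp.sum_coeff_pow_le_one (2 * n) (S ^ r))
    rw [← nsmul_eq_mul]
    refine Finset.card_nsmul_le_sum _ _ _ fun t ht => ?_
    have := convNormSq_translate_sub_le (p ^ n) (hCn n) r t ht
    rw [hp.convNormSq_pow_translate_sub, ← hq, ← hd] at this
    linarith
  set y := √(2 / (c * q)) with hy
  have hy0 : 0 < y := Real.sqrt_pos.2 (by positivity)
  have hy2 : y ^ 2 = 2 / (c * q) := Real.sq_sqrt (by positivity)
  set r := ⌈y⌉₊ with hr
  have hr1 : y ≤ r := Nat.le_ceil y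
  have hr2 : (r : ℝ) < y + 1 := Nat.ceil_lt_add_one hy0.le
  have hr0 : (0 : ℝ) < r := hy0.trans_le hr1
  have key : q ≤ r ^ 2 * (C * d) := by
    by_contra! hlt
    have h1 := hball r
    have h2 : c * (r : ℝ) ^ 2 * (q / 2) < (S ^ r).card * (q - r ^ 2 * (C * d) / 2) :=
      mul_lt_mul' (hgrow r) (by linarith) (by positivity)
        (lt_of_lt_of_le (by positivity) (hgrow r))
    have h3 : c * (y ^ 2) * (q / 2) ≤ c * (r : ℝ) ^ 2 * (q / 2) := by gcongr
    have h4 : c * (y ^ 2) * (q / 2) = 1 := by rw [hy2]; field_simp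
    linarith
  have hr3 : (r : ℝ) ^ 2 ≤ 2 * (2 / (c * q) + 1) := by
    rw [← hy2]
    nlinarith [sq_nonneg (y - 1)]
  calc q ^ 2 = q * q := sq q
    _ ≤ q * (2 * (2 / (c * q) + 1) * (C * d)) := by
        gcongr
        exact key.trans (by gcongr)
    _ = 2 * (2 / c + q) * C * d := by field_simp
    _ ≤ _ := by gcongr

lemma tendsto_coeff_pow_even {D : ℝ} (hD : ∀ n : ℕ, (p ^ (2 * n)).coeff 1 ^ 2 ≤
      D * ((p ^ (2 * n)).coeff 1 - (p ^ (2 * (n + 1))).coeff 1)) :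
    Tendsto (fun n : ℕ => (p ^ (2 * n)).coeff 1) atTop (𝓝 0) := by
  have hlim := tendsto_atTop_ciInf hp.coeff_pow_even_antitone
    ⟨0, by rintro _ ⟨n, rfl⟩; exact hp.coeff_pow_nonneg _ _⟩
  set L := ⨅ n : ℕ, (p ^ (2 * n)).coeff 1
  have h1 := (hlim.sub (hlim.comp (tendsto_add_atTop_nat 1))).const_mul D
  have h2 := le_of_tendsto_of_tendsto' (hlim.pow 2) h1 hD
  have h3 : L = 0 := by
    rw [sub_self, mul_zero] at h2
    exact pow_eq_zero_iff two_ne_zero |>.1 (le_antisymm h2 (sq_nonneg L))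
  rwa [h3] at hlim

lemma exists_summable_bound_translate [DecidableEq G]
    (hball : ∀ x : G, ∃ n : ℕ, x ∈ S ^ n) {D : ℝ} (hD0 : 0 < D)
    (hD : ∀ n : ℕ, (p ^ (2 * n)).coeff 1 ^ 2 ≤
      D * ((p ^ (2 * n)).coeff 1 - (p ^ (2 * (n + 1))).coeff 1)) (t : G) :
    ∃ b : ℕ → ℝ, Summable b ∧
      ∀ n x, |(p ^ (2 * n)).coeff (x * t) - (p ^ (2 * n)).coeff x| ≤ b n := by
  obtain ⟨C, hC, hCn⟩ := hp.exists_coeff_sub_le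
  obtain ⟨r, hr⟩ := hball t
  let q : ℕ → ℝ := fun n => (p ^ (2 * n)).coeff 1
  have hq0 : ∀ n, 0 ≤ q n := fun n => hp.coeff_pow_nonneg _ _
  have hanti : ∀ n, √(q (n + 1)) ≤ √(q n) := fun n =>
    Real.sqrt_le_sqrt (hp.coeff_pow_even_antitone n.le_succ)
  refine ⟨fun n => √(4 * D * C * r ^ 2) * (√(q n) - √(q (n + 1))), Summable.mul_left _ ?_, ?_⟩
  · refine summable_of_sum_range_le (c := √(q 0)) (fun n => sub_nonneg.2 (hanti n)) fun n => ?_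
    rw [Finset.sum_range_sub']
    linarith [Real.sqrt_nonneg (q n)]
  · intro n x
    have hnn : 0 ≤ √(q n) - √(q (n + 1)) := sub_nonneg.2 (hanti n)
    refine abs_le_of_sq_le_sq ?_ (by positivity)
    refine (hp.sq_coeff_translate_sub_le n t x).trans ?_
    have h1 := convNormSq_translate_sub_le (p ^ n) (hCn n) r t hr
    have h2 : q n * (q n - q (n + 1)) ≤ 4 * D * (√(q n) - √(q (n + 1))) ^ 2 := by
      rcases (hq0 n).eq_or_lt with h | h
      · rw [← h, zero_mul]; positivity
      · have ha := Real.sq_sqrt (hq0 n)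
        have hb := Real.sq_sqrt (hq0 (n + 1))
        have hd : q n - q (n + 1) =
            (√(q n) - √(q (n + 1))) * (√(q n) + √(q (n + 1))) := by
          nlinarith
        have hd0 : 0 ≤ q n - q (n + 1) := sub_nonneg.2 (hp.coeff_pow_even_antitone n.le_succ)
        have h3 : (√(q n) + √(q (n + 1))) ^ 2 ≤ 4 * q n := by
          nlinarith [hanti n, Real.sqrt_nonneg (q n), Real.sqrt_nonneg (q (n + 1))]
        refine le_of_mul_le_mul_left ?_ h
        calc q n * (q n * (q n - q (n + 1))) = q n ^ 2 * (q n - q (n + 1)) := by ring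
          _ ≤ D * (q n - q (n + 1)) * (q n - q (n + 1)) := by gcongr; exact hD n
          _ = D * (√(q n) - √(q (n + 1))) ^ 2 * (√(q n) + √(q (n + 1))) ^ 2 := by
              rw [hd]; ring
          _ ≤ D * (√(q n) - √(q (n + 1))) ^ 2 * (4 * q n) := by gcongr
          _ = _ := by ring
    rw [mul_pow, Real.sq_sqrt (by positivity)]
    calc q n * convNormSq (p ^ n * single t⁻¹ 1 - p ^ n)
        ≤ q n * (r ^ 2 * (C * (q n - q (n + 1)))) := by
          have := hq0 n
          gcongr
      _ = C * r ^ 2 * (q n * (q n - q (n + 1))) := by ring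
      _ ≤ C * r ^ 2 * (4 * D * (√(q n) - √(q (n + 1))) ^ 2) := by gcongr
      _ = _ := by ring

end IsLazyWalk

end Walk

section Potential

open MonoidAlgebra
open scoped Pointwise

variable {G : Type*} [Group G] {S : Finset G} {p : MonoidAlgebra ℝ G}

/-- The `n`-th term of the series defining the potential kernel of a random walk. -/
noncomputable def potentialTerm (p : MonoidAlgebra ℝ G) (n : ℕ) (x : G) : ℝ :=
  2 * (p ^ (2 * n)).coeff 1 - ((p ^ (2 * n)).coeff x + (p ^ (2 * n + 1)).coeff x)

lemma tendsto_coeff_cofinite {X : Type*} (a : MonoidAlgebra ℝ X) : Tendsto a.coeff cofinite (𝓝 0) :=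
  tendsto_nhds_of_eventually_eq (by
    rw [eventually_cofinite]
    exact a.coeff.hasFiniteSupport)

lemma tendsto_potentialTerm (p : MonoidAlgebra ℝ G) (n : ℕ) :
    Tendsto (potentialTerm p n) cofinite (𝓝 (2 * (p ^ (2 * n)).coeff 1)) := by
  have := ((tendsto_coeff_cofinite (p ^ (2 * n))).add
    (tendsto_coeff_cofinite (p ^ (2 * n + 1)))).const_sub (2 * (p ^ (2 * n)).coeff 1)
  rwa [add_zero, sub_zero] at this

namespace IsLazyWalk

variable (hp : IsLazyWalk S p)
include hp

lemma potentialTerm_nonneg (n : ℕ) (x : G) : 0 ≤ potentialTerm p n x := by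
  have h1 := hp.coeff_pow_even_le n x
  have h2 := hp.coeff_pow_odd_le n x
  unfold potentialTerm
  linarith

lemma potentialTerm_inv (n : ℕ) (x : G) : potentialTerm p n x⁻¹ = potentialTerm p n x := by
  simp only [potentialTerm, hp.coeff_pow_inv]

lemma sum_potentialTerm_sub (n : ℕ) (x : G) :
    ∑ s ∈ S, p.coeff s * potentialTerm p n (x * s) - potentialTerm p n x =
      (p ^ (2 * n)).coeff x - (p ^ (2 * (n + 1))).coeff x := by
  simp only [potentialTerm, mul_sub, mul_add, Finset.sum_sub_distrib, Finset.sum_add_distrib,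
    ← hp.coeff_pow_succ_eq_sum_right, ← Finset.sum_mul, hp.sum_eq_one]
  ring_nf

lemma abs_coeff_odd_sub_le {n : ℕ} {t : G} {b : ℝ}
    (hb : ∀ x, |(p ^ (2 * n)).coeff (x * t) - (p ^ (2 * n)).coeff x| ≤ b) (x : G) :
    |(p ^ (2 * n + 1)).coeff (x * t) - (p ^ (2 * n + 1)).coeff x| ≤ b := by
  rw [pow_succ', hp.coeff_mul_eq_sum, hp.coeff_mul_eq_sum, ← Finset.sum_sub_distrib]
  refine (Finset.abs_sum_le_sum_abs _ _).trans ?_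
  calc _ ≤ ∑ s ∈ S, p.coeff s * b := by
        refine Finset.sum_le_sum fun s _ => ?_
        rw [← mul_sub, abs_mul, abs_of_nonneg (hp.nonneg s), ← mul_assoc s⁻¹ x t]
        exact mul_le_mul_of_nonneg_left (hb _) (hp.nonneg s)
    _ = b := by rw [← Finset.sum_mul, hp.sum_eq_one, one_mul]

lemma tendsto_tsum_potentialTerm_of_summable
    (hq : Summable fun n : ℕ => (p ^ (2 * n)).coeff 1) :
    Tendsto (fun x => ∑' n, potentialTerm p n x) cofinite
      (𝓝 (∑' n : ℕ, 2 * (p ^ (2 * n)).coeff 1)) := by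
  refine tendsto_tsum_of_dominated_convergence (hq.mul_left 2)
    (fun n => tendsto_potentialTerm p n) (Eventually.of_forall fun x n => ?_)
  rw [Real.norm_eq_abs, abs_of_nonneg (hp.potentialTerm_nonneg n x)]
  have h1 := hp.coeff_pow_nonneg (2 * n) x
  have h2 := hp.coeff_pow_nonneg (2 * n + 1) x
  unfold potentialTerm
  linarith

section

variable (hbd : ∀ t : G, ∃ b : ℕ → ℝ, Summable b ∧
  ∀ n x, |(p ^ (2 * n)).coeff (x * t) - (p ^ (2 * n)).coeff x| ≤ b n)
include hbd

lemma summable_potentialTerm (x : G) : Summable fun n => potentialTerm p n x := by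
  have heven : ∀ t : G, Summable fun n => (p ^ (2 * n)).coeff 1 - (p ^ (2 * n)).coeff t := by
    intro t
    obtain ⟨b, hb, hbn⟩ := hbd t
    refine Summable.of_nonneg_of_le (fun n => sub_nonneg.2 (hp.coeff_pow_even_le n t))
      (fun n => ?_) hb
    have := (abs_le.1 (hbn n 1)).1
    rw [one_mul] at this
    linarith
  have hodd : Summable fun n => ∑ s ∈ S, p.coeff s *
      ((p ^ (2 * n)).coeff 1 - (p ^ (2 * n)).coeff (x * s)) :=
    summable_sum fun s _ => (heven _).mul_left _
  refine ((heven x).add hodd).congr fun n => ?_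
  simp only [mul_sub, Finset.sum_sub_distrib, ← hp.coeff_pow_succ_eq_sum_right, ← Finset.sum_mul,
    hp.sum_eq_one, potentialTerm]
  ring

lemma tendsto_tsum_potentialTerm_sub (t : G) :
    Tendsto (fun x => ∑' n, potentialTerm p n (x * t) - ∑' n, potentialTerm p n x)
      cofinite (𝓝 0) := by
  obtain ⟨b, hb, hbn⟩ := hbd t
  have hinj : Tendsto (fun x : G => x * t) cofinite cofinite :=
    (mul_left_injective t).tendsto_cofinite
  have h := tendsto_tsum_of_dominated_convergence (𝓕 := cofinite)
    (f := fun x n => potentialTerm p n (x * t) - potentialTerm p n x) (g := fun _ => (0 : ℝ))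
    (bound := fun n => 2 * b n) (hb.mul_left 2)
    (fun n => by
      simpa using ((tendsto_potentialTerm p n).comp hinj).sub (tendsto_potentialTerm p n))
    (Eventually.of_forall fun x n => by
      have h1 := abs_le.1 (hbn n x)
      have h2 := abs_le.1 (hp.abs_coeff_odd_sub_le (hbn n) x)
      rw [Real.norm_eq_abs, abs_le]
      unfold potentialTerm
      constructor <;> linarith)
  rw [tsum_zero] at h
  refine h.congr fun x => ?_
  rw [(hp.summable_potentialTerm hbd _).tsum_sub (hp.summable_potentialTerm hbd _)]

lemma sum_tsum_potentialTerm_sub [DecidableEq G]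
    (hlim : Tendsto (fun n : ℕ => (p ^ (2 * n)).coeff 1) atTop (𝓝 0)) (x : G) :
    ∑ s ∈ S, p.coeff s * ∑' n, potentialTerm p n (x * s) - ∑' n, potentialTerm p n x =
      if x = 1 then 1 else 0 := by
  have hs := hp.summable_potentialTerm hbd
  have h1 : HasSum (fun n => (p ^ (2 * n)).coeff x - (p ^ (2 * (n + 1))).coeff x)
      (∑ s ∈ S, p.coeff s * ∑' n, potentialTerm p n (x * s) - ∑' n, potentialTerm p n x) := by
    simp only [← hp.sum_potentialTerm_sub]
    exact (hasSum_sum fun s _ => (hs (x * s)).hasSum.mul_left _).sub (hs x).hasSum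
  have h2 : Tendsto (fun n : ℕ => (p ^ (2 * n)).coeff x) atTop (𝓝 0) :=
    squeeze_zero (fun n => hp.coeff_pow_nonneg _ _) (fun n => hp.coeff_pow_even_le n x) hlim
  have h3 := h1.tendsto_sum_nat
  simp only [Finset.sum_range_sub' (fun n => (p ^ (2 * n)).coeff x)] at h3
  have h4 := h2.const_sub ((p ^ (2 * 0)).coeff x)
  rw [tendsto_nhds_unique h3 h4, mul_zero, pow_zero, coeff_one_apply, sub_zero]

lemma tendsto_tsum_potentialTerm_of_not_summable
    (hq : ¬ Summable fun n : ℕ => (p ^ (2 * n)).coeff 1) :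
    Tendsto (fun x => ∑' n, potentialTerm p n x) cofinite atTop := by
  rw [tendsto_atTop]
  intro M
  have h1 := (not_summable_iff_tendsto_nat_atTop_of_nonneg
    (fun n => hp.coeff_pow_nonneg (2 * n) 1)).1 hq
  obtain ⟨N, hN⟩ := (h1.eventually (eventually_gt_atTop (M / 2))).exists
  have h2 : Tendsto (fun x => ∑ n ∈ Finset.range N, potentialTerm p n x) cofinite
      (𝓝 (∑ n ∈ Finset.range N, 2 * (p ^ (2 * n)).coeff 1)) :=
    tendsto_finsetSum _ fun n _ => tendsto_potentialTerm p n
  rw [← Finset.mul_sum] at h2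
  filter_upwards [h2.eventually (eventually_gt_nhds (show M < _ by linarith))] with x hx
  exact hx.le.trans ((hp.summable_potentialTerm hbd x).sum_le_tsum _
    fun n _ => hp.potentialTerm_nonneg n x)

end

/-- A lazy walk on a group of at least quadratic growth has a potential kernel whose increments
vanish at infinity. -/
theorem exists_potential [DecidableEq G] (hball : ∀ x : G, ∃ n : ℕ, x ∈ S ^ n)
    {c : ℝ} (hc : 0 < c) (hgrow : ∀ n : ℕ, c * (n : ℝ) ^ 2 ≤ (S ^ n).card) :
    ∃ A : G → ℝ, (∀ x, A x⁻¹ = A x) ∧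
      (∀ x, A x - ∑ s ∈ S, p.coeff s * A (x * s) = if x = 1 then 1 else 0) ∧
      (∀ t, Tendsto (fun x => A (x * t) - A x) cofinite (𝓝 0)) ∧
      (Tendsto A cofinite (𝓝 0) ∨ Tendsto A cofinite atBot) := by
  obtain ⟨D, hD0, hD⟩ := hp.exists_sq_coeff_le hc hgrow
  have hbd := hp.exists_summable_bound_translate hball hD0 hD
  have hlim := hp.tendsto_coeff_pow_even hD
  by_cases hq : Summable fun n : ℕ => (p ^ (2 * n)).coeff 1
  · refine ⟨fun x => ∑' n : ℕ, 2 * (p ^ (2 * n)).coeff 1 - ∑' n, potentialTerm p n x,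
      fun x => by simp only [hp.potentialTerm_inv], fun x => ?_, fun t => ?_, Or.inl ?_⟩
    · rw [← hp.sum_tsum_potentialTerm_sub hbd hlim x]
      simp only [mul_sub, Finset.sum_sub_distrib, ← Finset.sum_mul, hp.sum_eq_one]
      ring
    · have := (hp.tendsto_tsum_potentialTerm_sub hbd t).neg
      rw [neg_zero] at this
      exact this.congr fun x => by ring
    · simpa using (hp.tendsto_tsum_potentialTerm_of_summable hq).const_sub
        (∑' n : ℕ, 2 * (p ^ (2 * n)).coeff 1)
  · refine ⟨fun x => -∑' n, potentialTerm p n x,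
      fun x => by simp only [hp.potentialTerm_inv], fun x => ?_, fun t => ?_, Or.inr ?_⟩
    · rw [← hp.sum_tsum_potentialTerm_sub hbd hlim x]
      simp only [mul_neg, Finset.sum_neg_distrib]
      ring
    · have := (hp.tendsto_tsum_potentialTerm_sub hbd t).neg
      rw [neg_zero] at this
      exact this.congr fun x => by ring
    · exact tendsto_neg_atTop_atBot.comp (hp.tendsto_tsum_potentialTerm_of_not_summable hbd hq)

end IsLazyWalk

end Potential

section Kernel

open MonoidAlgebra
open scoped Pointwise

variable {G : Type*} [Group G] {f : G → ℤ}

lemma WellBalancedZ.sum_eq_zero (hf : WellBalancedZ f) : ∑ s ∈ hf.1.toFinset, f s = 0 := by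
  rw [← finsum_eq_sum f hf.1]
  exact hf.2.1

lemma WellBalancedZ.apply_one_pos [Nontrivial G] (hf : WellBalancedZ f) : 0 < f 1 := by
  by_contra! h1
  have hle : ∀ s, f s ≤ 0 := fun s => by
    rcases eq_or_ne s 1 with rfl | hs
    · exact h1
    · exact hf.2.2.1 s hs
  have h0 := (Finset.sum_eq_zero_iff_of_nonpos fun s _ => hle s).1 hf.sum_eq_zero
  have hsupp : Function.support f = ∅ := by
    ext s
    simp only [Function.mem_support, Set.mem_empty_iff_false, iff_false, not_not]
    by_contra hs
    exact hs (h0 s (by simpa using hs))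
  have := hf.2.2.2.2
  rw [hsupp, Subgroup.closure_empty] at this
  exact bot_ne_top this

/-- The lazy random walk attached to a well-balanced element of the group ring. -/
lemma WellBalancedZ.exists_isLazyWalk [Nontrivial G] [DecidableEq G] (hf : WellBalancedZ f) :
    ∃ p : MonoidAlgebra ℝ G, IsLazyWalk hf.1.toFinset p ∧
      ∀ s, p.coeff s = (if s = 1 then 1 else 0) - (f s : ℝ) / (2 * f 1) := by
  have hpos : (0 : ℝ) < f 1 := by exact_mod_cast hf.apply_one_pos
  have hone : (1 : G) ∈ hf.1.toFinset := by simpa using hf.apply_one_pos.ne'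
  let P : G → ℝ := fun s => (if s = 1 then 1 else 0) - (f s : ℝ) / (2 * f 1)
  have hP1 : P 1 = 1 / 2 := by
    simp only [P, if_true]
    field_simp
    norm_num
  have hPs : ∀ s, s ≠ 1 → P s = -(f s : ℝ) / (2 * f 1) := fun s hs => by
    simp only [P, if_neg hs, zero_sub, neg_div]
  have hmem : ∀ s, s ∈ hf.1.toFinset ↔ P s ≠ 0 := by
    intro s
    rcases eq_or_ne s 1 with rfl | hs
    · simp [hP1, hf.apply_one_pos.ne']
    · simp [hPs s hs, hf.apply_one_pos.ne']
  let F : G →₀ ℝ := ⟨hf.1.toFinset, P, hmem⟩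
  refine ⟨ofCoeff F, ⟨fun s => ?_, rfl, hone, ?_, ?_⟩, fun s => rfl⟩
  · change 0 ≤ P s
    rcases eq_or_ne s 1 with rfl | hs
    · rw [hP1]; norm_num
    · rw [hPs s hs]
      have : (f s : ℝ) ≤ 0 := by exact_mod_cast hf.2.2.1 s hs
      exact div_nonneg (neg_nonneg.2 this) (by positivity)
  · ext s
    rw [coeff_convFlip]
    change P s⁻¹ = P s
    simp only [P, inv_eq_one, hf.2.2.2.1]
  · change ∑ s ∈ hf.1.toFinset, P s = 1
    have : ∑ s ∈ hf.1.toFinset, (f s : ℝ) = 0 := by exact_mod_cast hf.sum_eq_zero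
    simp only [P, Finset.sum_sub_distrib, ← Finset.sum_div, this, zero_div, sub_zero,
      Finset.sum_ite_eq', if_pos hone]

/-- A fundamental solution of a well-balanced element whose increments vanish at infinity. -/
structure IsKernel [DecidableEq G] (S : Finset G) (f : G → ℤ) (K : G → ℝ) : Prop where
  inv : ∀ x, K x⁻¹ = K x
  sum_eq : ∀ x, ∑ s ∈ S, (f s : ℝ) * K (x * s) = if x = 1 then 1 else 0
  tendsto_sub : ∀ t, Tendsto (fun x => K (x * t) - K x) cofinite (𝓝 0)
  tendsto : Tendsto K cofinite (𝓝 0) ∨ Tendsto K cofinite atBot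

theorem WellBalancedZ.exists_isKernel [Infinite G] [DecidableEq G] (hf : WellBalancedZ f)
    (hZ : ∀ N : Subgroup G, N.Normal → N.FiniteIndex → IsEmpty (N ≃* Multiplicative ℤ)) :
    ∃ K : G → ℝ, IsKernel hf.1.toFinset f K := by
  have hpos : (0 : ℝ) < f 1 := by exact_mod_cast hf.apply_one_pos
  obtain ⟨p, hp, hpf⟩ := hf.exists_isLazyWalk
  have hinv : ∀ s ∈ hf.1.toFinset, s⁻¹ ∈ hf.1.toFinset := fun s hs => hp.inv_mem hs
  have hgen : Subgroup.closure (hf.1.toFinset : Set G) = ⊤ := by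
    rw [Set.Finite.coe_toFinset]
    exact hf.2.2.2.2
  obtain ⟨c, hc, hgrow⟩ := exists_quadratic_le_card_pow hZ hp.one_mem hinv hgen
  obtain ⟨A, hA1, hA2, hA3, hA4⟩ :=
    hp.exists_potential (exists_mem_pow hp.one_mem hinv hgen) hc hgrow
  refine ⟨fun x => A x / (2 * f 1), fun x => by rw [hA1], fun x => ?_, fun t => ?_, ?_⟩
  · rw [← hA2 x]
    have e : ∀ s, (f s : ℝ) * (A (x * s) / (2 * f 1)) =
        (if s = 1 then A (x * s) else 0) - p.coeff s * A (x * s) := fun s => by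
      rw [hpf]
      split_ifs <;> ring
    simp only [e, Finset.sum_sub_distrib, Finset.sum_ite_eq', if_pos hp.one_mem, mul_one]
  · have := (hA3 t).div_const (2 * (f 1 : ℝ))
    rw [zero_div] at this
    exact this.congr fun x => by ring
  · refine hA4.imp (fun h => ?_) (fun h => ?_)
    · simpa using h.div_const (2 * (f 1 : ℝ))
    · exact h.atBot_div_const (by positivity)

end Kernel

section Density

variable {G : Type*} [Group G]

lemma finite_support_of_tendsto_of_int {X : Type*} {u : X → ℝ} {v : X → ℤ}
    (huv : ∀ x, u x = v x) (hu : Tendsto u cofinite (𝓝 0)) : (Function.support v).Finite := by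
  have h := hu.eventually (Metric.ball_mem_nhds (0 : ℝ) one_pos)
  rw [eventually_cofinite] at h
  refine h.subset fun x hx hx' => hx ?_
  rw [huv, Real.dist_0_eq_abs] at hx'
  exact Int.abs_lt_one_iff.1 (by exact_mod_cast hx')

lemma AddCircle.exists_int_of_coe_eq_zero {a : ℝ} (h : (a : UnitAddCircle) = 0) :
    ∃ m : ℤ, a = m := by
  obtain ⟨m, hm⟩ := (AddCircle.coe_eq_zero_iff 1).1 h
  exact ⟨m, by simpa using hm.symm⟩

lemma AddCircle.coe_eq_zero_of_int (m : ℤ) : ((m : ℝ) : UnitAddCircle) = 0 :=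
  (AddCircle.coe_eq_zero_iff 1).2 ⟨m, by simp⟩

lemma AddCircle.coe_sum_mul {ι : Type*} (T : Finset ι) (n : ι → ℤ) (a : ι → ℝ) :
    ((∑ i ∈ T, (n i : ℝ) * a i : ℝ) : UnitAddCircle) = ∑ i ∈ T, n i • (a i : UnitAddCircle) := by
  have : ∀ b : ℝ, (b : UnitAddCircle) = QuotientAddGroup.mk' (AddSubgroup.zmultiples (1 : ℝ)) b :=
    fun _ => rfl
  simp only [this, map_sum, ← zsmul_eq_mul, map_zsmul]

/-- If left translation by every generator changes `u` at only finitely many points, then `u` has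
finite range. -/
lemma finite_range_of_finite_ne {S : Set G} (hS : S.Finite) (hinv : ∀ s ∈ S, s⁻¹ ∈ S)
    (hgen : Subgroup.closure S = ⊤) {α : Type*} {u : G → α}
    (hu : ∀ s ∈ S, {x | u (s * x) ≠ u x}.Finite) : (Set.range u).Finite := by
  let F : Set G := ⋃ s ∈ S, (fun x => s * x) '' {x | u (s * x) ≠ u x}
  have hF : F.Finite := hS.biUnion fun s hs => (hu s hs).image _
  refine ((hF.insert 1).image u).subset ?_
  rintro _ ⟨y, rfl⟩
  have step : ∀ s ∈ S, ∀ y, u y ∈ u '' insert 1 F → u (s * y) ∈ u '' insert 1 F := by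
    intro s hs y hy
    by_cases h : u (s * y) = u y
    · rwa [h]
    · exact ⟨s * y, Or.inr (Set.mem_biUnion hs ⟨y, h, rfl⟩), rfl⟩
  have hy : y ∈ Subgroup.closure S := by rw [hgen]; trivial
  induction hy using Subgroup.closure_induction_left with
  | one => exact ⟨1, Or.inl rfl, rfl⟩
  | mul_left s hs y _ ih => exact step s hs y ih
  | inv_mul_cancel s hs y _ ih => exact step _ (hinv s hs) y ih

namespace IsKernel

variable [DecidableEq G] {S : Finset G} {f : G → ℤ} {K : G → ℝ} (hK : IsKernel S f K)
include hK

lemma tendsto_sub_left (r : G) : Tendsto (fun x => K (r * x) - K x) cofinite (𝓝 0) := by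
  have h := (hK.tendsto_sub r⁻¹).comp (inv_injective (G := G)).tendsto_cofinite
  refine h.congr fun x => ?_
  rw [Function.comp_apply, ← mul_inv_rev, hK.inv, hK.inv]

lemma sum_eq_left (hfinv : ∀ s, f s⁻¹ = f s) (hinv : ∀ s ∈ S, s⁻¹ ∈ S) (x : G) :
    ∑ s ∈ S, (f s : ℝ) * K (s * x) = if x = 1 then 1 else 0 := by
  have h := hK.sum_eq x⁻¹
  simp only [inv_eq_one] at h
  rw [← h]
  refine Finset.sum_bij' (fun s _ => s⁻¹) (fun s _ => s⁻¹) hinv hinv (by simp) (by simp) ?_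
  intro s _
  rw [hfinv, ← mul_inv_rev, hK.inv]

lemma tendsto_sum_sub {ι : Type*} [Fintype ι] (n : ι → ℤ) (t : ι → G) :
    Tendsto (fun x => ∑ i, (n i : ℝ) * K (x * t i) - (∑ i, n i : ℤ) * K x) cofinite (𝓝 0) := by
  have h : Tendsto (fun x => ∑ i, (n i : ℝ) * (K (x * t i) - K x)) cofinite
      (𝓝 (∑ i, (n i : ℝ) * 0)) :=
    tendsto_finsetSum _ fun i _ => (hK.tendsto_sub (t i)).const_mul _
  simp only [mul_zero, Finset.sum_const_zero] at h
  refine h.congr fun x => ?_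
  push_cast
  simp only [mul_sub, Finset.sum_sub_distrib, Finset.sum_mul]

lemma tendsto_sum_sub_left {ι : Type*} [Fintype ι] (n : ι → ℤ) (t : ι → G) (r : G) :
    Tendsto (fun x => ∑ i, (n i : ℝ) * K (r * x * t i) - ∑ i, (n i : ℝ) * K (x * t i))
      cofinite (𝓝 0) := by
  have h : Tendsto (fun x => ∑ i, (n i : ℝ) * (K (r * (x * t i)) - K (x * t i))) cofinite
      (𝓝 (∑ i, (n i : ℝ) * 0)) :=
    tendsto_finsetSum _ fun i _ => ((hK.tendsto_sub_left r).comp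
      (mul_left_injective (t i)).tendsto_cofinite).const_mul _
  simp only [mul_zero, Finset.sum_const_zero] at h
  refine h.congr fun x => ?_
  simp only [mul_sub, Finset.sum_sub_distrib, mul_assoc]

/-- A finite combination of translates of the kernel that pairs integrally with the homoclinic
points is an integer-valued finitely supported function. -/
lemma exists_finite_support [Infinite G] (hinv : ∀ s ∈ S, s⁻¹ ∈ S)
    (hgen : Subgroup.closure (S : Set G) = ⊤) {ι : Type*} [Fintype ι] (n : ι → ℤ) (t : ι → G)
    (hsub : ∀ r, ∃ m : ℤ, ∑ i, (n i : ℝ) * (K (r * t i) - K (t i)) = m)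
    (hzero : Tendsto K cofinite (𝓝 0) → ∀ r, ∃ m : ℤ, ∑ i, (n i : ℝ) * K (r * t i) = m) :
    ∃ v : G → ℤ, (Function.support v).Finite ∧ ∀ x, ∑ i, (n i : ℝ) * K (x * t i) = v x := by
  set u : G → ℝ := fun x => ∑ i, (n i : ℝ) * K (x * t i) with hu
  have hsub' : ∀ x, ∃ m : ℤ, u x - u 1 = m := fun x => by
    obtain ⟨m, hm⟩ := hsub x
    refine ⟨m, ?_⟩
    rw [← hm]
    simp only [hu, mul_sub, Finset.sum_sub_distrib, one_mul]
  suffices h : (∀ x, ∃ m : ℤ, u x = m) ∧ Tendsto u cofinite (𝓝 0) by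
    choose v hv using h.1
    exact ⟨v, finite_support_of_tendsto_of_int hv h.2, hv⟩
  rcases hK.tendsto with h0 | hbot
  · refine ⟨hzero h0, ?_⟩
    have h : Tendsto u cofinite (𝓝 (∑ i, (n i : ℝ) * 0)) :=
      tendsto_finsetSum _ fun i _ =>
        (h0.comp (mul_left_injective (t i)).tendsto_cofinite).const_mul _
    simpa using h
  · by_cases hn : ∑ i, n i = 0
    · have hu0 : Tendsto u cofinite (𝓝 0) := by
        refine (hK.tendsto_sum_sub n t).congr fun x => ?_
        rw [hn, Int.cast_zero, zero_mul, sub_zero]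
      refine ⟨?_, hu0⟩
      have hmem : 0 - u 1 ∈ Set.range ((↑) : ℤ → ℝ) :=
        Int.isClosedEmbedding_coe_real.isClosed_range.mem_of_tendsto (hu0.sub_const (u 1))
          (Eventually.of_forall fun x => by
            obtain ⟨m, hm⟩ := hsub' x
            exact ⟨m, hm.symm⟩)
      obtain ⟨k, hk⟩ := hmem
      intro x
      obtain ⟨m, hm⟩ := hsub' x
      exact ⟨m - k, by push_cast; linarith⟩
    · exfalso
      choose w hw using hsub'
      have hfin : (Set.range u).Finite := by
        refine finite_range_of_finite_ne S.finite_toSet hinv hgen fun s _ => ?_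
        have := finite_support_of_tendsto_of_int (v := fun x => w (s * x) - w x)
          (fun x => by push_cast; rw [← hw, ← hw]; ring) (hK.tendsto_sum_sub_left n t s)
        refine this.subset fun x hx h => hx ?_
        have h' : (w (s * x) : ℝ) = w x := by exact_mod_cast sub_eq_zero.1 h
        rw [← hw, ← hw] at h'
        linarith
      have hmK : Tendsto (fun x => |((∑ i, n i : ℤ) : ℝ) * K x|) cofinite atTop := by
        simp only [abs_mul]
        exact (tendsto_abs_atBot_atTop.comp hbot).const_mul_atTop
          (abs_pos.2 (by exact_mod_cast hn))
      obtain ⟨B, hB⟩ := (hfin.image fun a : ℝ => |a|).bddAbove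
      have h1 := (hK.tendsto_sum_sub n t).eventually (Metric.ball_mem_nhds (0 : ℝ) one_pos)
      obtain ⟨x, hx1, hx2⟩ := (h1.and (hmK.eventually (eventually_gt_atTop (B + 1)))).exists
      have hx3 : |u x| ≤ B := hB ⟨u x, ⟨x, rfl⟩, rfl⟩
      rw [Real.dist_0_eq_abs] at hx1
      have hx4 := abs_sub_abs_le_abs_sub (((∑ i, n i : ℤ) : ℝ) * K x) (u x)
      rw [abs_sub_comm] at hx4
      linarith

end IsKernel

lemma mem_XfSet_iff {f : G → ℤ} {S : Finset G} (hS : Function.support f ⊆ S)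
    (x : G → UnitAddCircle) : x ∈ XfSet f ↔ ∀ t, ∑ s ∈ S, f s • x (t * s) = 0 := by
  refine forall_congr' fun t => ?_
  rw [finsum_eq_sum_of_support_subset]
  intro s hs
  refine hS fun h => hs ?_
  simp [h]

/-- The homoclinic group of `XfSet f`. -/
def homoclinicGroup (f : G → ℤ) (hf : (Function.support f).Finite) :
    AddSubgroup (G → UnitAddCircle) where
  carrier := {x ∈ XfSet f | Tendsto x cofinite (𝓝 0)}
  zero_mem' := by
    refine ⟨fun t => ?_, tendsto_const_nhds⟩
    simp
  add_mem' := by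
    rintro x y ⟨hx, hx'⟩ ⟨hy, hy'⟩
    rw [mem_XfSet_iff hf.coe_toFinset.ge] at hx hy
    refine ⟨(mem_XfSet_iff hf.coe_toFinset.ge _).2 fun t => ?_, by rw [← add_zero 0]; exact hx'.add hy'⟩
    simp only [Pi.add_apply, smul_add, Finset.sum_add_distrib, hx, hy, add_zero]
  neg_mem' := by
    rintro x ⟨hx, hx'⟩
    rw [mem_XfSet_iff hf.coe_toFinset.ge] at hx
    refine ⟨(mem_XfSet_iff hf.coe_toFinset.ge _).2 fun t => ?_, by rw [← neg_zero]; exact hx'.neg⟩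
    simp only [Pi.neg_apply, smul_neg, Finset.sum_neg_distrib, hx, neg_zero]

/-- A point lies in the closure of a subgroup of a torus of arbitrary dimension as soon as it is
killed by every character that kills the subgroup. -/
lemma mem_closure_of_forall_finite_character {X : Type*} (H : AddSubgroup (X → UnitAddCircle))
    (y : X → UnitAddCircle)
    (hy : ∀ (I : Finset X) (n : I → ℤ), (∀ h ∈ H, ∑ i, n i • h i = 0) → ∑ i, n i • y i = 0) :
    y ∈ closure (H : Set (X → UnitAddCircle)) := by
  rw [mem_closure_iff]
  intro U hU hyU
  obtain ⟨I, u, hu, hIU⟩ := isOpen_pi_iff.1 hU y hyU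
  let res : (X → UnitAddCircle) →+ (I → UnitAddCircle) :=
    { toFun := fun x i => x i, map_zero' := rfl, map_add' := fun _ _ => rfl }
  have hcl : res y ∈ closure (H.map res : Set (I → UnitAddCircle)) := by
    refine mem_closure_of_forall_character _ _ fun n hn => hy I n fun h hh => ?_
    exact hn (res h) ⟨h, hh, rfl⟩
  rw [mem_closure_iff] at hcl
  obtain ⟨_, hz, h, hh, rfl⟩ := hcl (Set.univ.pi fun i : I => u i)
    (isOpen_set_pi Set.finite_univ fun i _ => (hu i i.2).1) fun i _ => (hu i i.2).2
  exact ⟨h, hIU fun i hi => hz ⟨i, hi⟩ trivial, hh⟩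

/-- Integral finitely supported combinations of the defining equations vanish on `XfSet f`. -/
lemma sum_smul_eq_zero_of_mem_XfSet [DecidableEq G] {f : G → ℤ} {S : Finset G}
    (hS : Function.support f ⊆ S) {y : G → UnitAddCircle} (hy : y ∈ XfSet f)
    {ι : Type*} [Fintype ι] (n : ι → ℤ) (t : ι → G) {v : G → ℤ}
    (hv : (Function.support v).Finite)
    (hn : ∀ x, ∑ s ∈ S, f s * v (s * x) = ∑ i, if x * t i = 1 then n i else 0) :
    ∑ i, n i • y (t i) = 0 := by
  rw [mem_XfSet_iff hS] at hy
  have hfin : ∀ s, (Function.support fun w => (f s * v (s * w⁻¹)) • y w).Finite := by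
    intro s
    have : Function.Injective fun w : G => s * w⁻¹ :=
      (mul_right_injective s).comp inv_injective
    refine (hv.preimage this.injOn).subset fun w hw h => hw ?_
    simp [h]
  have e1 : ∀ s, ∑ᶠ w, (f s * v (s * w⁻¹)) • y w = ∑ᶠ z, (f s * v z) • y (z⁻¹ * s) := by
    intro s
    rw [← finsum_comp_equiv ((Equiv.inv G).trans (Equiv.mulRight s))]
    simp
  have hfin' : ∀ s, (Function.support fun z => (f s * v z) • y (z⁻¹ * s)).Finite := by
    intro s
    refine hv.subset fun w hw h => hw ?_
    simp [h]
  calc ∑ i, n i • y (t i) = ∑ i, ∑ᶠ w, (if w⁻¹ * t i = 1 then n i else 0) • y w := by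
        refine Finset.sum_congr rfl fun i _ => ?_
        rw [finsum_eq_single _ (t i)]
        · simp
        · intro w hw
          rw [if_neg (fun h => hw (inv_mul_eq_one.1 h)), zero_smul]
    _ = ∑ᶠ w, ∑ i, (if w⁻¹ * t i = 1 then n i else 0) • y w := by
        rw [finsum_sum_comm]
        intro i _
        refine (Set.finite_singleton (t i)).subset fun w hw => ?_
        by_contra h
        exact hw (by simp [if_neg (fun h' => h (inv_mul_eq_one.1 h'))])
    _ = ∑ᶠ w, ∑ s ∈ S, (f s * v (s * w⁻¹)) • y w := by
        simp only [← Finset.sum_smul, hn]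
    _ = ∑ s ∈ S, ∑ᶠ z, (f s * v z) • y (z⁻¹ * s) := by
        rw [finsum_sum_comm _ _ fun s _ => hfin s]
        exact Finset.sum_congr rfl fun s _ => e1 s
    _ = ∑ᶠ z, ∑ s ∈ S, (f s * v z) • y (z⁻¹ * s) := by
        rw [finsum_sum_comm _ _ fun s _ => hfin' s]
    _ = 0 := by
        simp only [mul_comm (f _), mul_smul, ← Finset.smul_sum, hy, smul_zero, finsum_zero]

/-- A real function solving the defining equations up to integers and vanishing at infinity yields
a homoclinic point. -/
lemma coe_mem_homoclinicGroup {f : G → ℤ} (hf : (Function.support f).Finite) {a : G → ℝ}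
    (ha : ∀ t, ∃ m : ℤ, ∑ s ∈ hf.toFinset, (f s : ℝ) * a (t * s) = m)
    (ha0 : Tendsto a cofinite (𝓝 0)) :
    (fun t => (a t : UnitAddCircle)) ∈ homoclinicGroup f hf := by
  refine ⟨(mem_XfSet_iff hf.coe_toFinset.ge _).2 fun t => ?_, ?_⟩
  · obtain ⟨m, hm⟩ := ha t
    rw [← AddCircle.coe_sum_mul, hm, AddCircle.coe_eq_zero_of_int]
  · exact ((AddCircle.continuous_mk' (1 : ℝ)).tendsto 0).comp ha0

end Density

/-- The homoclinic group of `X_f` is dense in `X_f`. -/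
theorem stmt0 {G : Type*} [Group G] [Countable G] [Infinite G]
    (hZ : ∀ N : Subgroup G, N.Normal → N.FiniteIndex →
      IsEmpty (N ≃* Multiplicative ℤ) ∧ IsEmpty (N ≃* Multiplicative (ℤ × ℤ)))
    (f : G → ℤ) (hf : WellBalancedZ f) :
    XfSet f ⊆ closure {x ∈ XfSet f | Tendsto x cofinite (𝓝 0)} := by
  classical
  intro y hy
  obtain ⟨K, hK⟩ := hf.exists_isKernel fun N h₁ h₂ => (hZ N h₁ h₂).1
  have hinv : ∀ s ∈ hf.1.toFinset, s⁻¹ ∈ hf.1.toFinset := fun s hs => by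
    simpa [hf.2.2.2.1] using hs
  have hgen : Subgroup.closure (hf.1.toFinset : Set G) = ⊤ := by
    rw [Set.Finite.coe_toFinset]
    exact hf.2.2.2.2
  have hKint : ∀ r t, ∃ m : ℤ, ∑ s ∈ hf.1.toFinset, (f s : ℝ) * K (r * (t * s)) = m := by
    intro r t
    refine ⟨if r * t = 1 then 1 else 0, ?_⟩
    simp only [← mul_assoc r t, hK.sum_eq]
    push_cast
    rfl
  refine mem_closure_of_forall_finite_character (homoclinicGroup f hf.1) y fun I n hn => ?_
  have hpair : ∀ a : G → ℝ, (fun t => (a t : UnitAddCircle)) ∈ homoclinicGroup f hf.1 →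
      ∃ m : ℤ, ∑ i, (n i : ℝ) * a i = m := fun a ha =>
    AddCircle.exists_int_of_coe_eq_zero (by rw [AddCircle.coe_sum_mul]; exact hn _ ha)
  obtain ⟨v, hv, huv⟩ := hK.exists_finite_support hinv hgen n (fun i => (i : G))
    (fun r => hpair (fun t => K (r * t) - K t) <|
      coe_mem_homoclinicGroup hf.1 (fun t => by
        obtain ⟨m, hm⟩ := hKint r t
        obtain ⟨k, hk⟩ := hKint 1 t
        simp only [one_mul] at hk
        exact ⟨m - k, by simp only [mul_sub, Finset.sum_sub_distrib, hm, hk, Int.cast_sub]⟩)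
        (hK.tendsto_sub_left r))
    (fun h0 r => hpair (fun t => K (r * t)) <|
      coe_mem_homoclinicGroup hf.1 (hKint r) (h0.comp (mul_right_injective r).tendsto_cofinite))
  refine sum_smul_eq_zero_of_mem_XfSet hf.1.coe_toFinset.ge hy n (fun i => (i : G)) hv fun x => ?_
  have h : ∑ s ∈ hf.1.toFinset, (f s : ℝ) * v (s * x) =
      ∑ i : I, if x * (i : G) = 1 then (n i : ℝ) else 0 := by
    simp only [← huv, Finset.mul_sum]
    rw [Finset.sum_comm]
    refine Finset.sum_congr rfl fun i _ => ?_
    simp only [mul_left_comm (f _ : ℝ), mul_assoc _ x, ← Finset.mul_sum,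
      hK.sum_eq_left hf.2.2.2.1 hinv, mul_ite, mul_one, mul_zero]
  exact_mod_cast h
end

section
/- Let Γ be a countably infinite group, (Γ_n)_{n≥1} a sequence of finite-index normal subgroups of Γ with ⋂_{n≥1} ⋃_{i≥n} Γ_i = {e}, f ∈ ℤΓ well-balanced, and g ∈ ℤΓ. Then π_n(g) ∈ ℤ(Γ/Γ_n)·π_n(f) for every n ≥ 1 if and only if g ∈ ℤΓf, i.e. g = hf for some h ∈ ℤΓ. -/
open Filter Topology
open scoped Classical

noncomputable section

/-- The ring homomorphism `π_N : ℤΓ → ℤ(Γ/N)`, `π_N(g)_c = ∑_{sN = c} g_s`. -/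
def quotPush {G : Type*} [Group G] (N : Subgroup G) (g : G → ℤ) : (G ⧸ N) → ℤ :=
  fun c => ∑ᶠ s : G, if (QuotientGroup.mk s : G ⧸ N) = c then g s else 0

section finite
open scoped Pointwise
variable {G X : Type*} [Group G] [Group X] [Fintype X]

/-- Summation by parts for a symmetric weight on a finite quotient. -/
theorem two_mul_sum_mul_laplacian (p : G →* X) (T : Finset G) (hT : ∀ s ∈ T, s⁻¹ ∈ T)
    (c : G → ℤ) (hc : ∀ s, c s⁻¹ = c s) (H φ : X → ℤ) :
    2 * ∑ x, φ x * ∑ s ∈ T, c s * (H x - H (x * p s)) =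
      ∑ x, ∑ s ∈ T, c s * ((φ x - φ (x * p s)) * (H x - H (x * p s))) := by
  have key : ∑ x, ∑ s ∈ T, c s * (φ x * (H x - H (x * p s))) =
      ∑ x, ∑ s ∈ T, c s * (φ (x * p s) * (H (x * p s) - H x)) := by
    rw [Finset.sum_comm, Finset.sum_comm (s := Finset.univ) (t := T)]
    refine Finset.sum_nbij' (fun s => s⁻¹) (fun s => s⁻¹) hT hT (by simp) (by simp) ?_
    intro s _
    rw [← Equiv.sum_comp (Equiv.mulRight (p s⁻¹))]
    refine Finset.sum_congr rfl fun x _ => ?_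
    simp [hc]
  have e : ∑ x, φ x * ∑ s ∈ T, c s * (H x - H (x * p s)) =
      ∑ x, ∑ s ∈ T, c s * (φ x * (H x - H (x * p s))) := by
    refine Finset.sum_congr rfl fun x _ => ?_
    rw [Finset.mul_sum]
    exact Finset.sum_congr rfl fun s _ => by ring
  rw [two_mul]
  nth_rw 2 [e]
  rw [key, e, ← Finset.sum_add_distrib]
  refine Finset.sum_congr rfl fun x _ => ?_
  rw [← Finset.sum_add_distrib]
  exact Finset.sum_congr rfl fun s _ => by ring

/-- A solution of the Poisson equation has gradient bounded by the `ℓ¹` norm of the source. -/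
theorem abs_sub_le_two_mul_sum_abs (p : G →* X) (T : Finset G) (hT : ∀ s ∈ T, s⁻¹ ∈ T)
    (c : G → ℤ) (hc : ∀ s, c s⁻¹ = c s) (hpos : ∀ s ∈ T, 0 < c s) (H γ : X → ℤ)
    (hH : ∀ x, ∑ s ∈ T, c s * (H x - H (x * p s)) = γ x) (x : X) {s : G} (hs : s ∈ T) :
    |H x - H (x * p s)| ≤ 2 * ∑ y, |γ y| := by
  set t := max (H x) (H (x * p s)) with ht
  set φ : X → ℤ := fun y => if t ≤ H y then 1 else 0 with hφ
  have hnn : ∀ y, ∀ r ∈ T,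
      0 ≤ c r * ((φ y - φ (y * p r)) * (H y - H (y * p r))) := by
    intro y r hr
    refine mul_nonneg (hpos r hr).le ?_
    simp only [hφ]
    split_ifs <;> simp <;> omega
  have h1 : |H x - H (x * p s)| ≤ c s * ((φ x - φ (x * p s)) * (H x - H (x * p s))) := by
    have : |H x - H (x * p s)| = (φ x - φ (x * p s)) * (H x - H (x * p s)) := by
      simp only [hφ]
      rcases lt_trichotomy (H x) (H (x * p s)) with h | h | h
      · rw [abs_of_neg (by omega), if_neg (by omega), if_pos (by omega)]; ring
      · simp [h]
      · rw [abs_of_pos (by omega), if_pos (by omega), if_neg (by omega)]; ring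
    rw [← this]
    exact le_mul_of_one_le_left (abs_nonneg _) (hpos s hs)
  calc _ ≤ _ := h1
    _ ≤ ∑ r ∈ T, c r * ((φ x - φ (x * p r)) * (H x - H (x * p r))) :=
      Finset.single_le_sum (f := fun r => c r * ((φ x - φ (x * p r)) * (H x - H (x * p r))))
        (hnn x) hs
    _ ≤ ∑ y, ∑ r ∈ T, c r * ((φ y - φ (y * p r)) * (H y - H (y * p r))) :=
      Finset.single_le_sum
        (f := fun y => ∑ r ∈ T, c r * ((φ y - φ (y * p r)) * (H y - H (y * p r))))
        (fun y _ => Finset.sum_nonneg (hnn y)) (Finset.mem_univ x)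
    _ = 2 * ∑ y, φ y * γ y := by
      rw [← two_mul_sum_mul_laplacian p T hT c hc]; simp only [hH]
    _ ≤ _ := by
      gcongr with y
      simp only [hφ]
      split_ifs
      · simpa using le_abs_self _
      · simp

/-- From a point where `H` is not locally constant one descends along `T` to the support of the
source, in at most as many steps as `H` drops. -/
theorem exists_descent (p : G →* X) (T : Finset G) (hT : ∀ s ∈ T, s⁻¹ ∈ T)
    (c : G → ℤ) (hpos : ∀ s ∈ T, 0 < c s) (H γ : X → ℤ)
    (hH : ∀ x, ∑ s ∈ T, c s * (H x - H (x * p s)) = γ x) (x : X)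
    (hx : ∃ s ∈ T, H (x * p s) ≠ H x) :
    ∃ y, γ y ≠ 0 ∧ ∃ k : ℕ, (k : ℤ) ≤ H x - H y ∧
      ∃ z ∈ (insert 1 (T : Set G)) ^ k, x = y * p z := by
  obtain ⟨m, hm⟩ : ∃ m, ∀ y, m ≤ H y := by
    obtain ⟨y, hy⟩ := Finite.exists_min H
    exact ⟨H y, hy⟩
  induction hd : (H x - m).toNat using Nat.strong_induction_on generalizing x with
  | _ d ih =>
  by_cases hγ : γ x = 0
  · have hlow : ∃ s ∈ T, H (x * p s) < H x := by
      by_contra! hcon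
      obtain ⟨s, hs, hne⟩ := hx
      have : ∑ s ∈ T, c s * (H x - H (x * p s)) < ∑ s ∈ T, 0 := by
        refine Finset.sum_lt_sum (fun r hr => ?_) ⟨s, hs, ?_⟩
        · exact mul_nonpos_of_nonneg_of_nonpos (hpos r hr).le (by linarith [hcon r hr])
        · exact mul_neg_of_pos_of_neg (hpos s hs) (by have := hcon s hs; omega)
      rw [hH, hγ] at this
      simp at this
    obtain ⟨s, hs, hlt⟩ := hlow
    have hxs : x * p s * p s⁻¹ = x := by simp
    obtain ⟨y, hy, k, hk, z, hz, hzz⟩ := ih _ (by have := hm (x * p s); omega) (x * p s)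
      ⟨s⁻¹, hT s hs, by rw [hxs]; exact hlt.ne'⟩ rfl
    refine ⟨y, hy, k + 1, by push_cast; omega, z * s⁻¹, ?_, ?_⟩
    · rw [pow_succ]
      exact Set.mul_mem_mul hz (Or.inr (hT s hs))
    · rw [map_mul, ← mul_assoc, ← hzz, hxs]
  · exact ⟨x, hγ, 0, by simp, 1, by simp, by simp⟩

/-- In a finite group with generators `T`, a set `A` whose boundary lies in a connected set `B`
cannot contain a translate of `B` off `B` while its complement does too. -/
theorem not_separating (T B : Set X) (hT : ∀ s ∈ T, s⁻¹ ∈ T) (h1 : 1 ∈ B)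
    (hgen : ∀ U : Set X, (∀ x, ∀ s ∈ T, (x * s ∈ U ↔ x ∈ U)) → ∀ x, (x ∈ U ↔ 1 ∈ U))
    (hB : ∀ U : Set X, (∀ x ∈ B, ∀ s ∈ T, (x * s ∈ U ↔ x ∈ U)) → ∀ x ∈ B, (x ∈ U ↔ 1 ∈ U))
    (A : Set X) (hA : ∀ x ∉ B, ∀ s ∈ T, (x * s ∈ A ↔ x ∈ A))
    (u v : X) (huA : ∀ b ∈ B, u * b ∈ A) (huB : ∀ b ∈ B, u * b ∉ B)
    (hvA : ∀ b ∈ B, v * b ∉ A) (hvB : ∀ b ∈ B, v * b ∉ B) : False := by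
  wlog hcard : A.ncard ≤ Aᶜ.ncard generalizing A u v
  · exact this Aᶜ (fun x hx s hs => not_congr (hA x hx s hs)) v u hvA hvB
      (fun b hb => by simpa using huA b hb) huB (by rw [compl_compl]; omega)
  have hmeet : ¬ (∀ b ∈ B, b ∈ A) ∧ ¬ (∀ b ∈ B, b ∉ A) := by
    have inv : ∀ P : Prop, (∀ b ∈ B, (b ∈ A ↔ P)) → False := by
      intro P hP
      have := hgen A (fun x s hs => by
        by_cases hx : x ∈ B
        · by_cases hxs : x * s ∈ B
          · rw [hP _ hx, hP _ hxs]
          · simpa using (hA _ hxs s⁻¹ (hT s hs)).symm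
        · exact hA x hx s hs)
      have h2 := (this _).1 (huA 1 h1)
      exact hvA 1 h1 ((this _).2 h2)
    exact ⟨fun h => inv True (by simpa using h), fun h => inv False (by simpa using h)⟩
  have main : ∀ U : Set X, (∀ x ∉ B, ∀ s ∈ T, (x * s ∈ U ↔ x ∈ U)) → A.ncard ≤ U.ncard →
      (¬ (∀ b ∈ B, b ∈ U)) → (∀ b ∈ B, u⁻¹ * b ∉ U) → False := by
    intro U hU hle hnot hdis
    set V : Set X := {x | u⁻¹ * x ∈ U} with hV
    have hVc : V.ncard = U.ncard := by
      have : V = (fun x => u * x) '' U := by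
        ext x
        simp only [hV, Set.mem_ofPred_eq, Set.mem_image]
        exact ⟨fun h => ⟨_, h, by simp⟩, by rintro ⟨y, hy, rfl⟩; simpa⟩
      rw [this, Set.ncard_image_of_injective _ (mul_right_injective u)]
    have hVA : V ⊆ A := by
      have hinv := hgen (V \ A) (fun x s hs => by
        have stepV : u⁻¹ * x ∉ B → (x * s ∈ V ↔ x ∈ V) := by
          intro h
          have := hU _ h s hs
          simpa [hV, mul_assoc] using this
        have stepA := hA x
        by_cases hx : x ∈ B
        · have hxV : x ∉ V := hdis x hx
          have : u⁻¹ * x ∉ B := fun h => huB _ h (by simpa using hx)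
          have := stepV this
          simp [this, hxV]
        · by_cases hux : u⁻¹ * x ∈ B
          · have : x ∈ A := by simpa using huA _ hux
            have h' := stepA hx s hs
            simp [this, h']
          · rw [Set.mem_sdiff, Set.mem_sdiff, stepV hux, stepA hx s hs])
      intro x hx
      by_contra hxA
      exact hdis 1 h1 ((hinv x).1 ⟨hx, hxA⟩).1
    have heq : V = A := Set.eq_of_subset_of_ncard_le hVA (by omega) (Set.toFinite _)
    refine hnot fun b hb => ?_
    have : u * b ∈ V := heq ▸ huA b hb
    simpa [hV] using this
  have hconn := hB {x | u⁻¹ * x ∈ A} (fun x hx s hs => by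
    have h : u⁻¹ * x ∉ B := fun h => huB _ h (by simpa using hx)
    simpa [mul_assoc] using hA _ h s hs)
  simp only [Set.mem_ofPred_eq] at hconn
  by_cases hu1 : u⁻¹ * 1 ∈ A
  · refine main Aᶜ (fun x hx s hs => not_congr (hA x hx s hs)) hcard ?_ ?_
    · exact hmeet.2
    · intro b hb
      simpa using (hconn b hb).2 hu1
  · exact main A hA le_rfl hmeet.1 fun b hb h => hu1 ((hconn b hb).1 h)
end finite

section quotients
open scoped Pointwise
variable {G : Type*} [Group G]

theorem exists_mem_pow_of_closure_eq_top {S : Set G} (hS : S⁻¹ = S)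
    (htop : Subgroup.closure S = ⊤) (x : G) : ∃ k : ℕ, x ∈ S ^ k := by
  have hx : x ∈ Subgroup.closure S := htop ▸ Subgroup.mem_top x
  induction hx using Subgroup.closure_induction with
  | mem x hx => exact ⟨1, by simpa using hx⟩
  | one => exact ⟨0, by simp⟩
  | mul x y _ _ hx hy =>
    obtain ⟨k, hk⟩ := hx
    obtain ⟨l, hl⟩ := hy
    exact ⟨k + l, by rw [pow_add]; exact Set.mul_mem_mul hk hl⟩
  | inv x _ hx =>
    obtain ⟨k, hk⟩ := hx
    refine ⟨k, ?_⟩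
    rw [← hS, inv_pow]
    simpa using hk

/-- A set stable under steps in `T` starting in the ball `S ^ R` is constant on this ball. -/
theorem mem_iff_of_mem_pow {X : Type*} [Group X] (p : G →* X) (T : Set G) (R : ℕ) (U : Set X)
    (hU : ∀ x ∈ p '' (insert 1 T) ^ R, ∀ s ∈ T, (x * p s ∈ U ↔ x ∈ U))
    {k : ℕ} (hk : k ≤ R) {z : G} (hz : z ∈ (insert 1 T) ^ k) : p z ∈ U ↔ 1 ∈ U := by
  induction k generalizing z with
  | zero => simp_all
  | succ k ih =>
    rw [pow_succ] at hz
    obtain ⟨y, hy, s, hs, rfl⟩ := Set.mem_mul.1 hz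
    rw [← ih (by omega) hy]
    rcases hs with rfl | hs
    · simp
    · rw [map_mul]
      exact hU _ ⟨y, Set.pow_subset_pow_right (by simp) (by omega) hy, rfl⟩ s hs

theorem abs_sub_le_of_mem_pow {X : Type*} [Group X] (p : G →* X) (T : Set G) (H : X → ℤ)
    {M : ℕ} (hM : ∀ x, ∀ s ∈ T, |H x - H (x * p s)| ≤ M) {k : ℕ} {z : G}
    (hz : z ∈ (insert 1 T) ^ k) (x : X) : |H x - H (x * p z)| ≤ k * M := by
  induction k generalizing z with
  | zero => simp_all
  | succ k ih =>
    rw [pow_succ] at hz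
    obtain ⟨y, hy, s, hs, rfl⟩ := Set.mem_mul.1 hz
    have h1 := ih hy
    have h2 : |H (x * p y) - H (x * p y * p s)| ≤ M := by
      rcases hs with rfl | hs
      · simp
      · exact hM _ s hs
    rw [map_mul, ← mul_assoc]
    calc _ ≤ |H x - H (x * p y)| + |H (x * p y) - H (x * p y * p s)| := abs_sub_le _ _ _
      _ ≤ k * M + M := add_le_add h1 h2
      _ = _ := by push_cast; ring

theorem quotPush_eq_sum (N : Subgroup G) {g : G → ℤ} (hg : (Function.support g).Finite)
    (x : G ⧸ N) :
    quotPush N g x = ∑ w ∈ hg.toFinset, if (QuotientGroup.mk w : G ⧸ N) = x then g w else 0 := by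
  refine finsum_eq_sum_of_support_subset _ fun w hw => ?_
  simp only [Function.mem_support, ne_eq, ite_eq_right_iff, Classical.not_imp] at hw
  simpa using hw.2

theorem exists_of_quotPush_ne_zero (N : Subgroup G) {g : G → ℤ} {x : G ⧸ N}
    (hx : quotPush N g x ≠ 0) : ∃ w ∈ Function.support g, (QuotientGroup.mk w : G ⧸ N) = x := by
  by_contra! hcon
  refine hx (finsum_eq_zero_of_forall_eq_zero fun w => ?_)
  split_ifs with hw
  · by_contra hgw
    exact hcon w hgw hw
  · rfl

theorem sum_abs_quotPush_le (N : Subgroup G) [Fintype (G ⧸ N)] {g : G → ℤ}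
    (hg : (Function.support g).Finite) :
    ∑ x, |quotPush N g x| ≤ ∑ w ∈ hg.toFinset, |g w| := by
  calc ∑ x, |quotPush N g x|
      ≤ ∑ x : G ⧸ N, ∑ w ∈ hg.toFinset,
          if (QuotientGroup.mk w : G ⧸ N) = x then |g w| else 0 := by
        refine Finset.sum_le_sum fun x _ => ?_
        rw [quotPush_eq_sum N hg]
        refine (Finset.abs_sum_le_sum_abs _ _).trans_eq (Finset.sum_congr rfl fun w _ => ?_)
        split_ifs <;> simp
    _ = _ := by
        rw [Finset.sum_comm]
        simp

theorem set_pow_finite {S : Set G} (hS : S.Finite) (k : ℕ) : (S ^ k).Finite := by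
  induction k with
  | zero => simp
  | succ k ih => rw [pow_succ]; exact ih.mul hS

theorem quotPush_mk_eq {N : Subgroup G} {g : G → ℤ} {a : G}
    (h : ∀ w ∈ Function.support g, w ≠ a → a⁻¹ * w ∉ N) :
    quotPush N g (QuotientGroup.mk a) = g a := by
  rw [quotPush, finsum_eq_single _ a]
  · simp
  · intro w hw
    by_cases hgw : g w = 0
    · simp [hgw]
    · rw [if_neg]
      intro e
      exact h w hgw hw (QuotientGroup.eq.1 e.symm)

/-- Integer solutions of the Poisson equation on the finite quotients yield a finitely supported
solution on the group. -/
theorem exists_finite_support_solution [Infinite G]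
    (N : ℕ → Subgroup G) [∀ n, (N n).Normal] [∀ n, (N n).FiniteIndex]
    (hev : ∀ x : G, x ≠ 1 → ∀ᶠ n in (hyperfilter ℕ : Filter ℕ), x ∉ N n)
    (T : Finset G) (hT : ∀ s ∈ T, s⁻¹ ∈ T)
    (hgen : ∀ x, ∃ k : ℕ, x ∈ (insert 1 (T : Set G)) ^ k)
    (c : G → ℤ) (hc : ∀ s, c s⁻¹ = c s) (hpos : ∀ s ∈ T, 0 < c s)
    (g : G → ℤ) (hg : (Function.support g).Finite) (H : ∀ n, G ⧸ N n → ℤ)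
    (hH : ∀ n x, ∑ s ∈ T, c s * (H n x - H n (x * QuotientGroup.mk' (N n) s)) =
      quotPush (N n) g x)
    (hH1 : ∀ n, H n 1 = 0) :
    ∃ h : G → ℤ, (Function.support h).Finite ∧
      ∀ a, ∑ s ∈ T, c s * (h a - h (a * s)) = g a := by
  set S : Set G := insert 1 (T : Set G) with hS
  have h1S : (1 : G) ∈ S := by simp [hS]
  have hSfin : S.Finite := T.finite_toSet.insert 1
  have : ∀ n, Fintype (G ⧸ N n) := fun n => Fintype.ofFinite _
  obtain ⟨M, hM⟩ : ∃ M : ℕ, ∀ n x, ∀ s ∈ T,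
      |H n x - H n (x * QuotientGroup.mk' (N n) s)| ≤ M := by
    refine ⟨(2 * ∑ w ∈ hg.toFinset, |g w|).toNat, fun n x s hs => ?_⟩
    rw [Int.toNat_of_nonneg (by positivity)]
    refine (abs_sub_le_two_mul_sum_abs (QuotientGroup.mk' (N n)) T hT c hc hpos (H n) _
      (hH n) x hs).trans ?_
    have := sum_abs_quotPush_le (N n) hg
    omega
  have hball : ∀ n (k : ℕ) z, z ∈ S ^ k → |H n (QuotientGroup.mk' (N n) z)| ≤ k * M := by
    intro n k z hz
    simpa [hH1] using abs_sub_le_of_mem_pow (QuotientGroup.mk' (N n)) T (H n) (hM n) hz 1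
  obtain ⟨r, hr⟩ : ∃ r : ℕ, Function.support g ⊆ S ^ r := by
    choose k hk using hgen
    refine ⟨hg.toFinset.sup k, fun w hw => Set.pow_subset_pow_right h1S ?_ (hk w)⟩
    exact Finset.le_sup (by simpa using hw)
  have hsrc : ∀ n x, quotPush (N n) g x ≠ 0 →
      (∃ w ∈ S ^ r, QuotientGroup.mk' (N n) w = x) ∧ |H n x| ≤ r * M := by
    intro n x hx
    obtain ⟨w, hw, rfl⟩ := exists_of_quotPush_ne_zero _ hx
    exact ⟨⟨w, hr hw, rfl⟩, hball n r w (hr hw)⟩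
  set R := r + 2 * (r * M) with hR
  have hloc : ∀ n x, x ∉ QuotientGroup.mk' (N n) '' S ^ R → ∀ s ∈ T,
      H n (x * QuotientGroup.mk' (N n) s) = H n x := by
    intro n x hx s hs
    by_contra hne
    obtain ⟨y, hy, k, hk, z, hz, hxz⟩ := exists_descent (QuotientGroup.mk' (N n)) T hT c hpos
      (H n) _ (hH n) x ⟨s, hs, hne⟩
    obtain ⟨y', hy', k', hk', -⟩ := exists_descent (QuotientGroup.mk' (N n)) T hT c hpos
      (fun x => -H n x) (fun x => -quotPush (N n) g x)
      (fun x => by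
        rw [← hH n x, ← Finset.sum_neg_distrib]
        exact Finset.sum_congr rfl fun s _ => by ring) x ⟨s, hs, by simpa using hne⟩
    obtain ⟨⟨w, hw, rfl⟩, hb⟩ := hsrc n y hy
    obtain ⟨-, hb'⟩ := hsrc n y' (by simpa using hy')
    rw [abs_le] at hb hb'
    have hkR : k ≤ 2 * (r * M) := by zify; linarith
    refine hx ⟨w * z, ?_, by rw [map_mul, ← hxz]⟩
    rw [hR, pow_add]
    exact Set.mul_mem_mul hw (Set.pow_subset_pow_right h1S hkR hz)
  have hlim : ∀ z : G, ∃ v : ℤ,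
      ∀ᶠ n in (hyperfilter ℕ : Filter ℕ), H n (QuotientGroup.mk' (N n) z) = v := by
    intro z
    obtain ⟨k, hk⟩ := hgen z
    have := (Ultrafilter.eventually_exists_mem_iff (f := hyperfilter ℕ)
      (P := fun v n => H n (QuotientGroup.mk' (N n) z) = v)
      (Set.finite_Icc (-(k * M : ℤ)) (k * M))).1
      (Eventually.of_forall fun n => ⟨_, abs_le.1 (hball n k z hk), rfl⟩)
    obtain ⟨v, -, hv⟩ := this
    exact ⟨v, hv⟩
  choose h hh using hlim
  have hBfin : (S ^ R).Finite := set_pow_finite hSfin R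
  have h1B : (1 : G) ∈ S ^ R := Set.one_mem_pow h1S
  have hhloc : ∀ x ∉ S ^ R, ∀ s ∈ T, h (x * s) = h x := by
    intro x hx s hs
    have hout : ∀ᶠ n in (hyperfilter ℕ : Filter ℕ), ∀ b ∈ S ^ R, x⁻¹ * b ∉ N n :=
      (hBfin.eventually_all).2 fun b hb => hev _ fun e => hx (by
        rw [inv_mul_eq_one] at e; rwa [e])
    obtain ⟨n, hn, e1, e2⟩ := (hout.and ((hh x).and (hh (x * s)))).exists
    rw [← e1, ← e2, map_mul]
    refine hloc n _ ?_ s hs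
    rintro ⟨b, hb, e⟩
    exact hn b hb (QuotientGroup.eq.1 e.symm)
  have heq : ∀ a, ∑ s ∈ T, c s * (h a - h (a * s)) = g a := by
    intro a
    have e1 : ∀ᶠ n in (hyperfilter ℕ : Filter ℕ), ∀ s ∈ T,
        H n (QuotientGroup.mk' (N n) (a * s)) = h (a * s) :=
      (Finset.eventually_all T).2 fun s _ => hh _
    have e2 : ∀ᶠ n in (hyperfilter ℕ : Filter ℕ), ∀ w ∈ Function.support g,
        w ≠ a → a⁻¹ * w ∉ N n :=
      (hg.eventually_all).2 fun w _ => by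
        by_cases hwa : w = a
        · simp [hwa]
        · filter_upwards [hev (a⁻¹ * w) (by rw [ne_eq, inv_mul_eq_one]; exact fun e => hwa e.symm)]
            with n hn _ using hn
    obtain ⟨n, h1, h2, h3⟩ := (e1.and (e2.and (hh a))).exists
    rw [← quotPush_mk_eq h2]
    refine Eq.trans (Finset.sum_congr rfl fun s hs => ?_) (hH n (QuotientGroup.mk' (N n) a))
    rw [← h3, ← h1 s hs, map_mul]
  have hcl : ∀ U : Set G, (∀ x, ∀ s ∈ T, (x * s ∈ U ↔ x ∈ U)) → ∀ x, (x ∈ U ↔ 1 ∈ U) := by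
    intro U hU x
    obtain ⟨k, hk⟩ := hgen x
    exact mem_iff_of_mem_pow (MonoidHom.id G) T k U (fun x _ s hs => hU x s hs) le_rfl hk
  have hrange : (Set.range h).Finite := by
    refine (hBfin.image h).subset ?_
    have step : ∀ x, ∀ s ∈ T, h x ∈ h '' S ^ R → h (x * s) ∈ h '' S ^ R := by
      intro x s hs hx
      by_cases hxs : x * s ∈ S ^ R
      · exact ⟨_, hxs, rfl⟩
      · have := hhloc _ hxs s⁻¹ (hT s hs)
        rw [mul_inv_cancel_right] at this
        rwa [← this]
    rintro _ ⟨x, rfl⟩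
    refine (hcl {x | h x ∈ h '' S ^ R} (fun x s hs => ⟨fun hx => ?_, step x s hs⟩) x).2
      ⟨1, h1B, rfl⟩
    simpa using step (x * s) s⁻¹ (hT s hs) hx
  obtain ⟨v, hv⟩ : ∃ v, {x | h x = v}.Infinite := by
    by_contra! hcon
    refine Set.infinite_univ (α := G) ?_
    refine (hrange.biUnion (t := fun v => {x | h x = v}) fun v _ => ?_).subset ?_
    · simpa using hcon v
    · intro x _
      simp
  have htrans : ∀ A : Set G, A.Infinite → ∃ u ∈ A, ∀ b ∈ S ^ R, u * b ∉ S ^ R := by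
    intro A hA
    obtain ⟨u, hu, hu'⟩ := hA.exists_notMem_finset (hBfin.mul hBfin.inv).toFinset
    refine ⟨u, hu, fun b hb hub => hu' ?_⟩
    simp only [Set.Finite.mem_toFinset]
    exact ⟨u * b, hub, b⁻¹, by simpa using hb, by simp⟩
  have hconst : ∀ u, (∀ b ∈ S ^ R, u * b ∉ S ^ R) → ∀ b ∈ S ^ R, h (u * b) = h u := by
    intro u hu b hb
    refine (mem_iff_of_mem_pow (MonoidHom.id G) T R {x | h (u * x) = h u} ?_ le_rfl hb).2
      (by simp)
    rintro _ ⟨x, hx, rfl⟩ s hs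
    have := hhloc _ (hu x hx) s hs
    simp [← mul_assoc, this]
  have hcofin : {x | h x ≠ v}.Finite := by
    by_contra hinf
    obtain ⟨u, huv, hu⟩ := htrans _ hv
    obtain ⟨w, hwv, hw⟩ := htrans _ hinf
    have hlimball : ∀ u, ∀ᶠ n in (hyperfilter ℕ : Filter ℕ), ∀ b ∈ S ^ R,
        H n (QuotientGroup.mk' (N n) (u * b)) = h (u * b) := fun u =>
      (hBfin.eventually_all).2 fun b _ => hh _
    have hdisj : ∀ u, (∀ b ∈ S ^ R, u * b ∉ S ^ R) → ∀ᶠ n in (hyperfilter ℕ : Filter ℕ),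
        ∀ b ∈ S ^ R, QuotientGroup.mk' (N n) (u * b) ∉ QuotientGroup.mk' (N n) '' S ^ R := by
      intro u hu
      have : ∀ᶠ n in (hyperfilter ℕ : Filter ℕ), ∀ b ∈ S ^ R, ∀ b' ∈ S ^ R,
          b'⁻¹ * (u * b) ∉ N n :=
        (hBfin.eventually_all).2 fun b hb => (hBfin.eventually_all).2 fun b' hb' =>
          hev _ fun e => hu b hb (by rw [inv_mul_eq_one] at e; rwa [← e])
      filter_upwards [this] with n hn b hb
      rintro ⟨b', hb', e⟩
      exact hn b hb b' hb' (QuotientGroup.eq.1 e)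
    obtain ⟨n, hu1, hu2, hw1, hw2⟩ := ((hlimball u).and ((hdisj u hu).and
      ((hlimball w).and (hdisj w hw)))).exists
    set p := QuotientGroup.mk' (N n) with hp
    refine not_separating (p '' T) (p '' S ^ R) ?_ ⟨1, h1B, map_one p⟩ ?_ ?_
      {x | H n x = v} ?_ (p u) (p w) ?_ ?_ ?_ ?_
    · rintro _ ⟨s, hs, rfl⟩
      exact ⟨s⁻¹, hT s hs, map_inv p s⟩
    · intro U hU x
      obtain ⟨x, rfl⟩ := QuotientGroup.mk'_surjective (N n) x
      obtain ⟨k, hk⟩ := hgen x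
      exact mem_iff_of_mem_pow p T k U (fun x _ s hs => hU x _ ⟨s, hs, rfl⟩) le_rfl hk
    · rintro U hU _ ⟨x, hx, rfl⟩
      exact mem_iff_of_mem_pow p T R U (fun x hx s hs => hU x hx _ ⟨s, hs, rfl⟩) le_rfl hx
    · rintro x hx _ ⟨s, hs, rfl⟩
      have := hloc n x hx s hs
      simp only [Set.mem_ofPred_eq]
      rw [this]
    · rintro _ ⟨b, hb, rfl⟩
      rw [← map_mul]
      exact (hu1 b hb).trans ((hconst u hu b hb).trans huv)
    · rintro _ ⟨b, hb, rfl⟩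
      rw [← map_mul]
      exact hu2 b hb
    · rintro _ ⟨b, hb, rfl⟩
      rw [← map_mul]
      exact fun e => hwv ((hconst w hw b hb).symm.trans ((hw1 b hb).symm.trans e))
    · rintro _ ⟨b, hb, rfl⟩
      rw [← map_mul]
      exact hw2 b hb
  refine ⟨fun x => h x - v, hcofin.subset fun x hx => ?_, fun a => ?_⟩
  · simpa [sub_eq_zero] using hx
  · simpa using heq a

/-- Convolution by a well-balanced element as a weighted Laplacian. -/
theorem WellBalancedZ.finsum_mul_eq {f : G → ℤ} (hf : WellBalancedZ f) (K : G → ℤ) (a : G) :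
    ∑ᶠ s, K (a * s⁻¹) * f s =
      ∑ s ∈ hf.1.toFinset.erase 1, -f s * (K a - K (a * s)) := by
  obtain ⟨hfin, hsum, -, hsymm, -⟩ := hf
  have hsum' : ∑ s ∈ hfin.toFinset, f s = 0 := by
    rw [← hsum, finsum_eq_sum_of_support_subset (s := hfin.toFinset) _ (by simp)]
  rw [Finset.sum_erase _ (by simp), finsum_eq_sum_of_support_subset (s := hfin.toFinset)]
  · calc ∑ s ∈ hfin.toFinset, K (a * s⁻¹) * f s
        = ∑ s ∈ hfin.toFinset, K (a * s) * f s := by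
          refine Finset.sum_nbij' (fun s => s⁻¹) (fun s => s⁻¹) ?_ ?_ ?_ ?_ ?_ <;>
            simp [hsymm]
      _ = ∑ s ∈ hfin.toFinset, K (a * s) * f s - K a * ∑ s ∈ hfin.toFinset, f s := by
          rw [hsum']; ring
      _ = _ := by
          rw [Finset.mul_sum, ← Finset.sum_sub_distrib]
          exact Finset.sum_congr rfl fun s _ => by ring
  · intro s hs
    simp only [Function.mem_support, ne_eq, mul_eq_zero, not_or] at hs
    simpa using hs.2

theorem finsum_mul_inv_mul_eq (h f : G → ℤ) (w : G) :
    ∑ᶠ s, h s * f (s⁻¹ * w) = ∑ᶠ s, h (w * s⁻¹) * f s := by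
  rw [← finsum_comp_equiv ((Equiv.inv G).trans (Equiv.mulLeft w))]
  simp

/-- The push-forward to a quotient is multiplicative. -/
theorem quotPush_convolution (N : Subgroup G) [N.Normal] {h f : G → ℤ}
    (hh : (Function.support h).Finite) (hf : (Function.support f).Finite) (a : G) :
    quotPush N (fun w => ∑ᶠ s, h s * f (s⁻¹ * w)) (QuotientGroup.mk a) =
      ∑ᶠ s, quotPush N h (QuotientGroup.mk (a * s⁻¹)) * f s := by
  have hL : ∀ w, ∑ᶠ s, h s * f (s⁻¹ * w) = ∑ t ∈ hh.toFinset, h t * f (t⁻¹ * w) := fun w =>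
    finsum_eq_sum_of_support_subset _ fun t ht => by
      simp only [Function.mem_support, ne_eq, mul_eq_zero, not_or] at ht
      simpa using ht.1
  have hR : ∑ᶠ s, quotPush N h (QuotientGroup.mk (a * s⁻¹)) * f s =
      ∑ s ∈ hf.toFinset, quotPush N h (QuotientGroup.mk (a * s⁻¹)) * f s :=
    finsum_eq_sum_of_support_subset _ fun t ht => by
      simp only [Function.mem_support, ne_eq, mul_eq_zero, not_or] at ht
      simpa using ht.2
  have hcoset : ∀ t s : G, (QuotientGroup.mk (t * s) : G ⧸ N) = QuotientGroup.mk a ↔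
      (QuotientGroup.mk t : G ⧸ N) = QuotientGroup.mk (a * s⁻¹) := fun t s => by
    rw [QuotientGroup.mk_mul, QuotientGroup.mk_mul, QuotientGroup.mk_inv, eq_mul_inv_iff_mul_eq]
  have hterm : ∀ t, ∑ᶠ w, (if (QuotientGroup.mk w : G ⧸ N) = QuotientGroup.mk a
      then h t * f (t⁻¹ * w) else 0) = ∑ s ∈ hf.toFinset,
        if (QuotientGroup.mk t : G ⧸ N) = QuotientGroup.mk (a * s⁻¹) then h t * f s else 0 := by
    intro t
    rw [← finsum_comp_equiv (Equiv.mulLeft t)]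
    simp only [Equiv.coe_mulLeft, inv_mul_cancel_left, hcoset]
    refine finsum_eq_sum_of_support_subset _ fun s hs => ?_
    simp only [Function.mem_support, ne_eq, ite_eq_right_iff, Classical.not_imp, mul_eq_zero,
      not_or] at hs
    simpa using hs.2.2
  rw [hR, quotPush]
  simp only [hL, quotPush_eq_sum N hh, Finset.sum_mul]
  rw [Finset.sum_comm]
  simp only [ite_mul, zero_mul]
  rw [← Finset.sum_congr rfl fun t _ => hterm t, ← finsum_sum_comm]
  · refine finsum_congr fun w => ?_
    split_ifs <;> simp
  · intro t _
    refine ((hf.image fun s => t * s)).subset fun w hw => ?_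
    simp only [Function.mem_support, ne_eq, ite_eq_right_iff, Classical.not_imp, mul_eq_zero,
      not_or] at hw
    exact ⟨t⁻¹ * w, hw.2.2, by simp⟩

end quotients

/-- `π_n(g) ∈ ℤ(Γ/Γ_n)·π_n(f)` for every `n` iff `g ∈ ℤΓ·f`.
(The convolution `h·π_n(f)` is written at a coset `aΓ_n` as `∑_{s∈Γ} h(as⁻¹Γ_n)·f_s`.) -/
theorem stmt13 {G : Type*} [Group G] [Countable G] [Infinite G]
    (N : ℕ → Subgroup G) (hnorm : ∀ n, (N n).Normal) (hfin : ∀ n, (N n).FiniteIndex)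
    (hconv : (⋂ n : ℕ, ⋃ i : ℕ, ⋃ (_ : n ≤ i), ((N i : Set G))) = {1})
    (f : G → ℤ) (hf : WellBalancedZ f)
    (g : G → ℤ) (hg : (Function.support g).Finite) :
    (∀ n : ℕ, ∃ h : (G ⧸ N n) → ℤ, ∀ a : G,
        quotPush (N n) g (QuotientGroup.mk a) =
          ∑ᶠ s : G, h (QuotientGroup.mk (a * s⁻¹)) * f s) ↔
      ∃ h : G → ℤ, (Function.support h).Finite ∧
        ∀ w : G, g w = ∑ᶠ s : G, h s * f (s⁻¹ * w) := by
  have := hnorm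
  have := hfin
  constructor
  · intro hloc
    choose H hH using hloc
    have hf' := hf
    obtain ⟨-, -, hneg, hsymm, htop⟩ := hf'
    have hev : ∀ x : G, x ≠ 1 → ∀ᶠ n in (hyperfilter ℕ : Filter ℕ), x ∉ N n := by
      intro x hx
      have : x ∉ ⋂ n : ℕ, ⋃ i : ℕ, ⋃ (_ : n ≤ i), (N i : Set G) := by rw [hconv]; exact hx
      simp only [Set.mem_iInter, Set.mem_iUnion, not_forall, not_exists] at this
      obtain ⟨n, hn⟩ := this
      exact Nat.hyperfilter_le_atTop
        (eventually_atTop.2 ⟨n, fun i hi hmem => hn i hi hmem⟩)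
    set T := hf.1.toFinset.erase 1 with hTdef
    have hmemT : ∀ s, s ∈ T ↔ s ≠ 1 ∧ f s ≠ 0 := fun s => by simp [hTdef]
    have hT : ∀ s ∈ T, s⁻¹ ∈ T := fun s hs => by
      rw [hmemT] at hs ⊢
      rwa [hsymm, ne_eq, inv_eq_one]
    have hgen := exists_mem_pow_of_closure_eq_top (S := insert 1 (T : Set G))
      (by
        ext s
        have : s⁻¹ ∈ T ↔ s ∈ T := ⟨fun h => by simpa using hT _ h, hT s⟩
        simp [this])
      (top_le_iff.1 (htop.symm.le.trans (Subgroup.closure_mono fun s hs => by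
        by_cases h1 : s = 1
        · exact Or.inl h1
        · exact Or.inr ((hmemT s).2 ⟨h1, hs⟩))))
    obtain ⟨h, hfinite, heq⟩ := exists_finite_support_solution N hev T hT hgen (fun s => -f s)
      (fun s => by rw [hsymm])
      (fun s hs => by
        rw [hmemT] at hs
        have := hneg s hs.1
        have := hs.2
        omega)
      g hg (fun n x => H n x - H n 1)
      (fun n x => by
        obtain ⟨a, rfl⟩ := QuotientGroup.mk_surjective x
        rw [hH n a, hf.finsum_mul_eq (fun b => H n (QuotientGroup.mk b)) a]
        exact Finset.sum_congr rfl fun s _ => by simp)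
      (fun n => sub_self _)
    refine ⟨h, hfinite, fun w => ?_⟩
    rw [finsum_mul_inv_mul_eq, hf.finsum_mul_eq h w, heq]
  · rintro ⟨h, hfinite, heq⟩ n
    refine ⟨quotPush (N n) h, fun a => ?_⟩
    rw [← quotPush_convolution (N n) hfinite hf.1, ← funext heq]
end
end
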